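/- If removing open regular neighbourhoods of 1-cells of a graph Γ embedded in a Möbius band F one at a time never cuts a complementary punctured Möbius band along an essential arc or essential simple closed curve, then there is a core curve of F disjoint from Γ. -/

import Mathlib

/-- The square `[0,1] × [-1,1]`. -/
abbrev MobSq : Type := ↥(Set.Icc (0:ℝ) 1) × ↥(Set.Icc (-1:ℝ) 1)

/-- The identification `(0, y) ~ (1, -y)` defining the Möbius band. -/
def mobRel (p q : MobSq) : Prop :=
  (p.1 : ℝ) = 0 ∧ (q.1 : ℝ) = 1 ∧ (q.2 : ℝ) = -(p.2 : ℝ)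

/-- The Möbius band, as a quotient of the square `[0,1] × [-1,1]`. -/
def MobiusBand : Type := Quot mobRel

noncomputable instance : TopologicalSpace MobiusBand :=
  inferInstanceAs (TopologicalSpace (Quot _))

/-- The boundary circle of the Möbius band. -/
def mobBdry : Set MobiusBand :=
  {x | ∃ p : MobSq, Quot.mk mobRel p = x ∧ |(p.2 : ℝ)| = 1}

/-- A core curve of the Möbius band: an embedded circle in the interior whose
complement is connected.  (The complement of any other embedded circle in a
Möbius band is disconnected, so this characterises core curves.) -/
def IsCoreCurve (γ : ↥(Metric.sphere (0:ℂ) 1) → MobiusBand) : Prop :=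
  Topology.IsEmbedding γ ∧ Disjoint (Set.range γ) mobBdry ∧
    IsConnected (Set.range γ)ᶜ

section
open Set

namespace MobArc

/-- `S` is an arc from `a` to `b`. -/
def IsArc {X : Type*} [TopologicalSpace X] (S : Set X) (a b : X) : Prop :=
  ∃ (f : ℝ → X) (l r : ℝ), l < r ∧ ContinuousOn f (Icc l r) ∧ InjOn f (Icc l r) ∧
    f l = a ∧ f r = b ∧ f '' Icc l r = S

/-- Arcwise connected sets. -/
def ArcConn {X : Type*} [TopologicalSpace X] (D : Set X) : Prop :=
  ∀ a ∈ D, ∀ b ∈ D, a ≠ b → ∃ S ⊆ D, IsArc S a b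

section arcs
variable {X : Type*} [TopologicalSpace X]

theorem IsArc.left_mem {S : Set X} {a b : X} (h : IsArc S a b) : a ∈ S := by
  obtain ⟨f, l, r, hlr, -, -, rfl, -, rfl⟩ := h
  exact mem_image_of_mem _ (left_mem_Icc.2 hlr.le)

theorem IsArc.right_mem {S : Set X} {a b : X} (h : IsArc S a b) : b ∈ S := by
  obtain ⟨f, l, r, hlr, -, -, -, rfl, rfl⟩ := h
  exact mem_image_of_mem _ (right_mem_Icc.2 hlr.le)

theorem IsArc.trans {S T : Set X} {a b c : X} (hS : IsArc S a b) (hT : IsArc T b c)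
    (hST : S ∩ T ⊆ {b}) : IsArc (S ∪ T) a c := by
  obtain ⟨f, l, r, hlr, hfc, hfi, hfl, hfr, rfl⟩ := hS
  obtain ⟨g, l', r', hlr', hgc, hgi, hgl, hgr, rfl⟩ := hT
  set g' : ℝ → X := fun t => g (t - r + l') with hg'
  set h : ℝ → X := fun t => if t ≤ r then f t else g' t with hh
  have e1 : EqOn h f (Icc l r) := fun t ht => by simp [hh, ht.2]
  have e2 : EqOn h g' (Icc r (r + (r' - l'))) := by
    intro t ht
    by_cases h1 : t ≤ r
    · have : t = r := le_antisymm h1 ht.1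
      subst this
      simp [hh, hg', hfr, hgl]
    · simp [hh, h1]
  have hm : MapsTo (fun t => t - r + l') (Icc r (r + (r' - l'))) (Icc l' r') := by
    intro t ht
    constructor <;> [linarith [ht.1]; linarith [ht.2]]
  have hg'c : ContinuousOn g' (Icc r (r + (r' - l'))) :=
    hgc.comp (by fun_prop) hm
  have hg'i : InjOn g' (Icc r (r + (r' - l'))) := by
    intro s hs t ht hst
    have := hgi (hm hs) (hm ht) hst
    simp at this; exact this
  have hg'im : g' '' (Icc r (r + (r' - l'))) = g '' Icc l' r' := by
    ext x; constructor
    · rintro ⟨t, ht, rfl⟩; exact ⟨_, hm ht, rfl⟩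
    · rintro ⟨t, ht, rfl⟩
      refine ⟨t + r - l', ⟨by linarith [ht.1], by linarith [ht.2]⟩, ?_⟩
      show g (t + r - l' - r + l') = g t
      congr 1; ring
  have hu : Icc l (r + (r' - l')) = Icc l r ∪ Icc r (r + (r' - l')) := by
    rw [Icc_union_Icc_eq_Icc hlr.le]; linarith
  have cross : ∀ s ∈ Icc l r, ∀ t ∈ Icc r (r + (r' - l')), h s = h t → s = t := by
    intro s hs t ht hst
    rw [e1 hs, e2 ht] at hst
    have h1 : f s ∈ f '' Icc l r ∩ g '' Icc l' r' :=
      ⟨mem_image_of_mem _ hs, by rw [hst, ← hg'im]; exact mem_image_of_mem _ ht⟩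
    have h2 : f s = b := hST h1
    have h3 : s = r := hfi hs (right_mem_Icc.2 hlr.le) (h2.trans hfr.symm)
    have h4 : t = r := hg'i ht (left_mem_Icc.2 (by linarith)) (by
      rw [← hst, h2, ← hgl]; simp [hg'])
    rw [h3, h4]
  refine ⟨h, l, r + (r' - l'), by linarith, ?_, ?_, ?_, ?_, ?_⟩
  · rw [hu]
    exact (hfc.congr e1).union_of_isClosed (hg'c.congr e2) isClosed_Icc isClosed_Icc
  · rw [hu]
    rintro s (hs | hs) t (ht | ht) hst
    · exact hfi hs ht (by rwa [e1 hs, e1 ht] at hst)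
    · exact cross s hs t ht hst
    · exact (cross t ht s hs hst.symm).symm
    · exact hg'i hs ht (by rwa [e2 hs, e2 ht] at hst)
  · rw [e1 (left_mem_Icc.2 hlr.le), hfl]
  · rw [e2 (right_mem_Icc.2 (by linarith)), ← hgr]; simp [hg']
  · rw [hu, image_union, e1.image_eq, e2.image_eq, hg'im]

theorem IsArc.sub {S A B : Set X} {a b : X} (hS : IsArc S a b) (hA : IsClosed A)
    (hB : IsClosed B) (hAB : Disjoint A B) (ha : a ∈ A) (hb : b ∈ B) :
    ∃ S' ⊆ S, ∃ a' b', IsArc S' a' b' ∧ S' ∩ A = {a'} ∧ S' ∩ B = {b'} := by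
  obtain ⟨f, l, r, hlr, hfc, hfi, rfl, rfl, rfl⟩ := hS
  have hcA : IsCompact (Icc l r ∩ f ⁻¹' A) :=
    isCompact_Icc.of_isClosed_subset (hfc.preimage_isClosed_of_isClosed isClosed_Icc hA)
      inter_subset_left
  obtain ⟨s, hs⟩ := hcA.exists_isGreatest ⟨l, left_mem_Icc.2 hlr.le, ha⟩
  have hsI := hs.1.1
  have hcB : IsCompact (Icc s r ∩ f ⁻¹' B) :=
    isCompact_Icc.of_isClosed_subset
      ((hfc.mono (Icc_subset_Icc_left hsI.1)).preimage_isClosed_of_isClosed isClosed_Icc hB)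
      inter_subset_left
  obtain ⟨t, ht⟩ := hcB.exists_isLeast ⟨r, right_mem_Icc.2 hsI.2, hb⟩
  have htI := ht.1.1
  have hst : s < t := by
    refine lt_of_le_of_ne htI.1 ?_
    rintro rfl
    exact disjoint_left.1 hAB hs.1.2 ht.1.2
  have hsub : Icc s t ⊆ Icc l r := Icc_subset_Icc hsI.1 htI.2
  refine ⟨f '' Icc s t, image_mono hsub, f s, f t,
    ⟨f, s, t, hst, hfc.mono hsub, hfi.mono hsub, rfl, rfl, rfl⟩, ?_, ?_⟩
  · ext x; constructor
    · rintro ⟨⟨u, hu, rfl⟩, hx⟩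
      have := hs.2 ⟨hsub hu, hx⟩
      rw [le_antisymm this hu.1]; rfl
    · rintro rfl
      exact ⟨mem_image_of_mem _ (left_mem_Icc.2 hst.le), hs.1.2⟩
  · ext x; constructor
    · rintro ⟨⟨u, hu, rfl⟩, hx⟩
      have := ht.2 ⟨⟨hu.1, hu.2.trans htI.2⟩, hx⟩
      rw [le_antisymm hu.2 this]; rfl
    · rintro rfl
      exact ⟨mem_image_of_mem _ (right_mem_Icc.2 hst.le), ht.1.2⟩

/-- A shortest odd chain produces a simple odd loop. -/
theorem chain_loop [T2Space X] (τ : X → X) (hτ2 : ∀ x, τ (τ x) = x)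
    (m : ℕ) (hm : 2 ≤ m) (E : ℕ → Set X)
    (hcl : ∀ j, IsClosed (E j)) (hac : ∀ j, ArcConn (E j))
    (hEm : E m = τ ⁻¹' (E 0))
    (hadj : ∀ j < m, (E j ∩ E (j + 1)).Nonempty)
    (hfar : ∀ a b, a + 2 ≤ b → b ≤ m → Disjoint (E a) (E b))
    (hodd : ∀ a b, 1 ≤ a → a < m → 1 ≤ b → b < m → Disjoint (E a) (τ ⁻¹' (E b)))
    (hself : Disjoint (E m) (τ ⁻¹' (E m))) :
    ∃ p S, IsArc S p (τ p) ∧ S ⊆ (⋃ j ∈ Icc 1 m, E j) ∧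
      ∀ x ∈ S, τ x ∈ S → x = p ∨ x = τ p := by
  have key : ∀ j, 1 ≤ j → j < m → ∃ p q A, IsArc A p q ∧ A ⊆ (⋃ l ∈ Icc 1 j, E l) ∧
      A ∩ E 0 = {p} ∧ A ∩ E (j + 1) = {q} := by
    intro j hj
    induction j, hj using Nat.le_induction with
    | base =>
      intro h1
      obtain ⟨a, ha0, ha1⟩ := hadj 0 (by omega)
      obtain ⟨b, hb1, hb2⟩ := hadj 1 h1
      have hd : Disjoint (E 0) (E 2) := hfar 0 2 (by omega) (by omega)
      obtain ⟨S, hSE, hS⟩ := hac 1 a ha1 b hb1 (by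
        rintro rfl; exact disjoint_left.1 hd ha0 hb2)
      obtain ⟨S', hS'S, p, q, h1, h2, h3⟩ := hS.sub (hcl 0) (hcl 2) hd ha0 hb2
      refine ⟨p, q, S', h1, ?_, h2, h3⟩
      intro x hx
      simp only [mem_iUnion]
      exact ⟨1, by simp, hSE (hS'S hx)⟩
    | succ j hj ih =>
      intro hjm
      obtain ⟨p, q, A, hA, hAs, hA0, hAj⟩ := ih (by omega)
      have hAd : Disjoint A (E (j + 2)) := by
        rw [disjoint_left]
        intro x hx hx'
        obtain ⟨l, hl, hxl⟩ : ∃ l ∈ Icc 1 j, x ∈ E l := by simpa using hAs hx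
        exact disjoint_left.1 (hfar l (j+2) (by have := hl.2; omega) (by omega)) hxl hx'
      have hqA : q ∈ A := hA.right_mem
      have hqE : q ∈ E (j + 1) := by
        have : q ∈ A ∩ E (j + 1) := by rw [hAj]; rfl
        exact this.2
      obtain ⟨b, hb1, hb2⟩ := hadj (j + 1) hjm
      obtain ⟨S, hSE, hS⟩ := hac (j + 1) q hqE b hb1 (by
        rintro rfl; exact disjoint_left.1 hAd hqA hb2)
      obtain ⟨S', hS'S, p', q', h1, h2, h3⟩ := hS.sub (A := {q}) isClosed_singleton (hcl (j + 2))
        (by rw [disjoint_singleton_left]; exact fun h => disjoint_left.1 hAd hqA h) rfl hb2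
      have hp' : p' = q := by
        have : p' ∈ S' ∩ {q} := by rw [h2]; rfl
        exact this.2
      subst hp'
      have hS'E : S' ⊆ E (j + 1) := hS'S.trans hSE
      refine ⟨p, q', A ∪ S', hA.trans h1 ?_, ?_, ?_, ?_⟩
      · rw [← hAj]; exact inter_subset_inter_right _ hS'E
      · intro x hx
        simp only [mem_iUnion]
        rcases hx with hx | hx
        · obtain ⟨l, hl, hxl⟩ : ∃ l ∈ Icc 1 j, x ∈ E l := by simpa using hAs hx
          exact ⟨l, ⟨hl.1, by have := hl.2; omega⟩, hxl⟩
        · exact ⟨j + 1, ⟨by omega, le_rfl⟩, hS'E hx⟩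
      · rw [union_inter_distrib_right, hA0, disjoint_iff_inter_eq_empty.1, union_empty]
        exact ((hfar 0 (j + 1) (by omega) (by omega)).symm).mono_left hS'E
      · rw [union_inter_distrib_right, disjoint_iff_inter_eq_empty.1 hAd, empty_union]
        exact h3
  obtain ⟨p, q, A, hA, hAs, hA0, hAm⟩ := key (m - 1) (by omega) (by omega)
  rw [show m - 1 + 1 = m by omega] at hAm
  have hAA : ∀ x ∈ A, τ x ∉ A := by
    intro x hx hx'
    obtain ⟨l, hl, hxl⟩ : ∃ l ∈ Icc 1 (m-1), x ∈ E l := by simpa using hAs hx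
    obtain ⟨l', hl', hxl'⟩ : ∃ l ∈ Icc 1 (m-1), τ x ∈ E l := by simpa using hAs hx'
    have := hl.2; have := hl'.2
    exact disjoint_left.1 (hodd l l' hl.1 (by omega) hl'.1 (by omega)) hxl hxl'
  have hp0 : p ∈ E 0 := by
    have : p ∈ A ∩ E 0 := by rw [hA0]; rfl
    exact this.2
  have hqm : q ∈ E m := by
    have : q ∈ A ∩ E m := by rw [hAm]; rfl
    exact this.2
  have hτp : τ p ∈ E m := by rw [hEm]; show τ (τ p) ∈ E 0; rwa [hτ2]
  have hne : q ≠ τ p := by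
    intro h
    exact hAA p hA.left_mem (h ▸ hA.right_mem)
  obtain ⟨B, hBE, hB⟩ := hac m q hqm (τ p) hτp hne
  refine ⟨p, A ∪ B, hA.trans hB ?_, ?_, ?_⟩
  · rw [← hAm]; exact inter_subset_inter_right _ hBE
  · intro x hx
    simp only [mem_iUnion]
    rcases hx with hx | hx
    · obtain ⟨l, hl, hxl⟩ : ∃ l ∈ Icc 1 (m-1), x ∈ E l := by simpa using hAs hx
      exact ⟨l, ⟨hl.1, by have := hl.2; omega⟩, hxl⟩
    · exact ⟨m, ⟨by omega, le_rfl⟩, hBE hx⟩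
  · have hAp : ∀ x ∈ A, x ∈ E 0 → x = p := fun x hx hx0 => by
      have : x ∈ A ∩ E 0 := ⟨hx, hx0⟩
      rw [hA0] at this; exact this
    rintro x (hx | hx) (hx' | hx')
    · exact absurd hx' (hAA x hx)
    · left
      have := hBE hx'
      rw [hEm] at this
      exact hAp x hx (by have h : τ (τ x) ∈ E 0 := this; rwa [hτ2] at h)
    · right
      have := hBE hx
      rw [hEm] at this
      rw [← hAp _ hx' this, hτ2]
    · exact absurd (hBE hx') (fun h => disjoint_left.1 hself (hBE hx) h)

/-- The combinatorial dichotomy. -/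
theorem dichotomy [T2Space X] (τ : X → X) (hτ : Continuous τ) (hτ2 : ∀ x, τ (τ x) = x)
    {ι : Type} [Finite ι] (D : ι → Set X) (hcl : ∀ i, IsClosed (D i)) (hac : ∀ i, ArcConn (D i))
    (hdis : ∀ i, Disjoint (D i) (τ ⁻¹' (D i))) :
    (∃ p S, IsArc S p (τ p) ∧ (∀ x ∈ S, ∃ i, x ∈ D i ∨ τ x ∈ D i) ∧
      ∀ x ∈ S, τ x ∈ S → x = p ∨ x = τ p) ∨
    ∃ K : Set X, IsClosed K ∧ Disjoint K (τ ⁻¹' K) ∧ K ∪ τ ⁻¹' K = ⋃ i, (D i ∪ τ ⁻¹' (D i)) := by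
  classical
  let E : ι × Bool → Set X := fun a => if a.2 then τ ⁻¹' (D a.1) else D a.1
  let σ : ι × Bool → ι × Bool := fun a => (a.1, !a.2)
  have hσ2 : ∀ a, σ (σ a) = a := fun a => by simp [σ]
  have hσE : ∀ a, E (σ a) = τ ⁻¹' (E a) := by
    rintro ⟨i, b⟩
    cases b
    · simp [E, σ]
    · ext x; simp [E, σ, hτ2]
  have hEcl : ∀ a, IsClosed (E a) := by
    rintro ⟨i, b⟩
    cases b
    · simpa [E] using hcl i
    · simpa [E] using (hcl i).preimage hτ
  have hEac : ∀ a, ArcConn (E a) := by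
    rintro ⟨i, b⟩
    cases b
    · simpa [E] using hac i
    · have : ArcConn (τ ⁻¹' (D i)) := by
        intro a ha b hb hab
        obtain ⟨S, hSD, f, l, r, hlr, hfc, hfi, hfl, hfr, hfS⟩ := hac i (τ a) ha (τ b) hb
          (fun h => hab (by rw [← hτ2 a, h, hτ2]))
        refine ⟨τ '' S, ?_, τ ∘ f, l, r, hlr, hτ.comp_continuousOn hfc, ?_, ?_, ?_, ?_⟩
        · rintro _ ⟨x, hx, rfl⟩
          show τ (τ x) ∈ D i
          rw [hτ2]; exact hSD hx
        · intro s hs t ht hst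
          exact hfi hs ht (by
            have := congrArg τ hst
            simpa [hτ2] using this)
        · simp [hfl, hτ2]
        · simp [hfr, hτ2]
        · rw [image_comp, hfS]
      simpa [E] using this
  have hEdis : ∀ a, Disjoint (E a) (E (σ a)) := by
    rintro ⟨i, b⟩
    cases b
    · simpa [E, σ] using hdis i
    · simpa [E, σ] using (hdis i).symm
  have hEmem : ∀ a x, x ∈ E a → ∃ i, x ∈ D i ∨ τ x ∈ D i := by
    rintro ⟨i, b⟩ x hx
    cases b
    · exact ⟨i, Or.inl (by simpa [E] using hx)⟩
    · exact ⟨i, Or.inr (by simpa [E] using hx)⟩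
  let R : ι × Bool → ι × Bool → Prop := fun a b => (E a ∩ E b).Nonempty
  have hRs : ∀ a b, R a b → R b a := fun a b h => by
    show (E b ∩ E a).Nonempty
    rw [inter_comm]; exact h
  have hRσ : ∀ a b, R a b → R (σ a) (σ b) := by
    rintro a b ⟨x, hx, hx'⟩
    refine ⟨τ x, ?_, ?_⟩
    · rw [hσE, mem_preimage, hτ2]; assumption
    · rw [hσE, mem_preimage, hτ2]; assumption
  by_cases hch : ∃ m : ℕ, ∃ c : ℕ → ι × Bool, (∀ j < m, R (c j) (c (j + 1))) ∧ c m = σ (c 0)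
  · left
    have hmin := fun k => Nat.find_min hch (m := k)
    obtain ⟨c, hc, hcm⟩ := Nat.find_spec hch
    set m := Nat.find hch with hm
    have h0 : m ≠ 0 := by
      intro h
      rw [h] at hcm
      have := congrArg Prod.snd hcm
      simp [σ] at this
    have h1 : m ≠ 1 := by
      intro h
      have h2 := hc 0 (by omega)
      rw [zero_add, ← h, hcm] at h2
      obtain ⟨x, hx, hx'⟩ := h2
      exact disjoint_left.1 (hEdis _) hx hx'
    have H1 : ∀ a b, a + 2 ≤ b → b ≤ m → Disjoint (E (c a)) (E (c b)) := by
      intro a b hab hbm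
      rw [disjoint_iff_inter_eq_empty]
      by_contra hne
      have hne : R (c a) (c b) := nonempty_iff_ne_empty.2 hne
      refine hmin (m - (b - a) + 1) (by omega)
        ⟨fun j => if j ≤ a then c j else c (j + (b - a) - 1), ?_, ?_⟩
      · intro j hj
        rcases lt_trichotomy j a with h | h | h
        · simp only [h.le, if_true, Nat.succ_le_of_lt h]
          exact hc j (by omega)
        · subst h
          simp only [le_refl, if_true, show ¬ (j + 1 ≤ j) by omega, if_false]
          rwa [show j + 1 + (b - j) - 1 = b by omega]
        · simp only [show ¬ (j ≤ a) by omega, show ¬ (j + 1 ≤ a) by omega, if_false]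
          have := hc (j + (b - a) - 1) (by omega)
          rwa [show j + (b - a) - 1 + 1 = j + 1 + (b - a) - 1 by omega] at this
      · simp only [show ¬ (m - (b - a) + 1 ≤ a) by omega, if_false, zero_le, if_true]
        rw [show m - (b - a) + 1 + (b - a) - 1 = m by omega, hcm]
    have H2 : ∀ a b, 1 ≤ a → a < m → 1 ≤ b → b < m → Disjoint (E (c a)) (τ ⁻¹' (E (c b))) := by
      have main : ∀ a b, 1 ≤ a → b < m → a ≤ b → ¬ R (c b) (σ (c a)) := by
        intro a b ha hb hab hR
        refine hmin (b - a + 1) (by omega)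
          ⟨fun j => if j ≤ b - a then c (j + a) else σ (c a), ?_, ?_⟩
        · intro j hj
          by_cases h : j < b - a
          · simp only [show j ≤ b - a by omega, show j + 1 ≤ b - a by omega, if_true]
            have := hc (j + a) (by omega)
            rwa [show j + a + 1 = j + 1 + a by omega] at this
          · simp only [show j ≤ b - a by omega, show ¬ (j + 1 ≤ b - a) by omega, if_true, if_false]
            rwa [show j + a = b by omega]
        · simp
      intro a b ha ham hb hbm
      rw [← hσE, disjoint_iff_inter_eq_empty]
      by_contra hne
      have hne : R (c a) (σ (c b)) := nonempty_iff_ne_empty.2 hne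
      rcases le_total a b with h | h
      · refine main a b ha hbm h ?_
        have := hRs _ _ (hRσ _ _ hne)
        rwa [hσ2] at this
      · exact main b a hb ham h hne
    obtain ⟨p, S, hS, hSE, hS2⟩ := chain_loop τ hτ2 m (by omega) (fun j => E (c j))
      (fun j => hEcl _) (fun j => hEac _) (by simp only [hcm, hσE]) hc H1 H2
      (by rw [← hσE]; exact hEdis _)
    refine ⟨p, S, hS, ?_, hS2⟩
    intro x hx
    obtain ⟨l, hl, hxl⟩ : ∃ l ∈ Icc 1 m, x ∈ E (c l) := by simpa using hSE hx
    exact hEmem _ _ hxl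
  · right
    let cls : ι × Bool → Set (ι × Bool) := fun a => {b | Relation.ReflTransGen R a b}
    have hsymm : ∀ a b, Relation.ReflTransGen R a b → Relation.ReflTransGen R b a := by
      intro a b h
      induction h with
      | refl => exact Relation.ReflTransGen.refl
      | tail _ hbd ih => exact Relation.ReflTransGen.head (hRs _ _ hbd) ih
    have hclsR : ∀ a b, Relation.ReflTransGen R a b → cls a = cls b := by
      intro a b h
      ext x
      exact ⟨fun hx => (hsymm a b h).trans hx, fun hx => h.trans hx⟩
    have hchain : ∀ a b, Relation.ReflTransGen R a b →
        ∃ m : ℕ, ∃ c : ℕ → ι × Bool, (∀ j < m, R (c j) (c (j + 1))) ∧ c 0 = a ∧ c m = b := by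
      intro a b h
      induction h with
      | refl => exact ⟨0, fun _ => a, by simp, rfl, rfl⟩
      | @tail b d hab hbd ih =>
        obtain ⟨m, c, hc, hc0, hcm⟩ := ih
        refine ⟨m + 1, fun j => if j ≤ m then c j else d, ?_, by simpa using hc0, by simp⟩
        intro j hj
        by_cases h : j < m
        · simp only [h.le, if_true, Nat.succ_le_of_lt h]
          exact hc j h
        · have : j = m := by omega
          subst this
          simpa [hcm] using hbd
    have hne : ∀ a, cls a ≠ cls (σ a) := by
      intro a h
      have h1 : σ a ∈ cls a := by rw [h]; exact Relation.ReflTransGen.refl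
      obtain ⟨m, c, hc, hc0, hcm⟩ := hchain _ _ h1
      exact hch ⟨m, c, hc, by rw [hcm, hc0]⟩
    let P : ι × Bool → Prop := fun a => WellOrderingRel (cls a) (cls (σ a))
    have hPσ : ∀ a, P (σ a) ↔ ¬ P a := by
      intro a
      simp only [P, hσ2]
      constructor
      · intro h h'
        exact asymm_of WellOrderingRel h h'
      · intro h
        rcases trichotomous_of WellOrderingRel (cls a) (cls (σ a)) with h1 | h1 | h1
        · exact absurd h1 h
        · exact absurd h1 (hne a)
        · exact h1
    have hPR : ∀ a b, R a b → P a → P b := by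
      intro a b h hPa
      have h1 := hclsR a b (Relation.ReflTransGen.single h)
      have h2 := hclsR _ _ (Relation.ReflTransGen.single (hRσ a b h))
      simp only [P] at hPa ⊢
      rwa [← h1, ← h2]
    have hpre : τ ⁻¹' (⋃ a ∈ {a | P a}, E a) = ⋃ a ∈ {a | ¬ P a}, E a := by
      ext x
      simp only [mem_preimage, mem_iUnion, mem_ofPred_eq, exists_prop]
      constructor
      · rintro ⟨a, ha, hx⟩
        refine ⟨σ a, ?_, by rw [hσE]; exact hx⟩
        rw [hPσ]; exact not_not.2 ha
      · rintro ⟨a, ha, hx⟩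
        refine ⟨σ a, (hPσ a).2 ha, ?_⟩
        rw [hσE, mem_preimage, hτ2]; assumption
    refine ⟨⋃ a ∈ {a | P a}, E a, ?_, ?_, ?_⟩
    · exact (Set.toFinite _).isClosed_biUnion (fun a _ => hEcl a)
    · rw [hpre, disjoint_left]
      intro x hx hx'
      simp only [mem_iUnion, mem_ofPred_eq, exists_prop] at hx hx'
      obtain ⟨a, ha, hxa⟩ := hx
      obtain ⟨b, hb, hxb⟩ := hx'
      exact hb (hPR a b ⟨x, hxa, hxb⟩ ha)
    · rw [hpre]
      ext x
      simp only [mem_union, mem_iUnion, mem_ofPred_eq, exists_prop, mem_preimage]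
      constructor
      · rintro (⟨a, _, h⟩ | ⟨a, _, h⟩) <;> exact hEmem _ _ h
      · rintro ⟨i, h | h⟩
        · by_cases hp : P (i, false)
          · exact Or.inl ⟨_, hp, by simpa [E] using h⟩
          · exact Or.inr ⟨_, hp, by simpa [E] using h⟩
        · by_cases hp : P (i, true)
          · exact Or.inl ⟨_, hp, by simpa [E] using h⟩
          · exact Or.inr ⟨_, hp, by simpa [E] using h⟩

end arcs
end MobArc

namespace MobArc

theorem int_const {A : Type*} [TopologicalSpace A] [PreconnectedSpace A] [Nonempty A]
    (g : A → ℝ) (hg : Continuous g) (hi : ∀ a, ∃ m : ℤ, g a = m) : ∃ m : ℤ, ∀ a, g a = m := by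
  choose m hm using hi
  have hmc : Continuous m := by
    rw [Int.isClosedEmbedding_coe_real.isEmbedding.continuous_iff]
    have : ((↑) : ℤ → ℝ) ∘ m = g := by ext a; exact (hm a).symm
    rw [this]; exact hg
  obtain ⟨a0⟩ := ‹Nonempty A›
  exact ⟨m a0, fun a => by rw [hm a, PreconnectedSpace.constant ‹_› hmc (x := a) (y := a0)]⟩

theorem circle_lift {A : Type*} [TopologicalSpace A] [SimplyConnectedSpace A]
    [LocallyPathConnectedSpace A] (u : A → Circle) (hu : Continuous u) :
    ∃ θ : A → ℝ, Continuous θ ∧ ∀ a, Circle.exp (θ a) = u a := by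
  obtain ⟨a0⟩ : Nonempty A := inferInstance
  obtain ⟨e0, he0⟩ := Circle.exp_surjective (u a0)
  obtain ⟨F, ⟨-, hF⟩, -⟩ := Circle.isCoveringMap_exp.existsUnique_continuousMap_lifts ⟨u, hu⟩ (a₀ := a0) (e₀ := e0) he0
  exact ⟨F, F.continuous, fun a => congrFun hF a⟩

theorem angle_lift {A : Type*} [TopologicalSpace A] [SimplyConnectedSpace A]
    [LocallyPathConnectedSpace A] (F : A → ℂ) (hF : Continuous F) (h0 : ∀ a, F a ≠ 0) :
    ∃ θ : A → ℝ, Continuous θ ∧ ∀ a, F a = ‖F a‖ * Complex.exp (θ a * Complex.I) := by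
  have hn : ∀ a, (‖F a‖ : ℂ) ≠ 0 := fun a => by simpa using h0 a
  let u : A → Circle := fun a => ⟨F a / ‖F a‖, by
    show F a / ‖F a‖ ∈ Metric.sphere (0 : ℂ) 1
    simp [h0 a]⟩
  have hu : Continuous u := by
    refine Continuous.subtype_mk ?_ _
    exact hF.div (by fun_prop) hn
  obtain ⟨θ, hθ, h⟩ := circle_lift u hu
  refine ⟨θ, hθ, fun a => ?_⟩
  have := congrArg (fun z : Circle => (z : ℂ)) (h a)
  simp only [Circle.coe_exp] at this
  rw [this]
  show F a = ‖F a‖ * (F a / ‖F a‖)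
  field_simp [hn a]

theorem cos_pos_close (h : ℝ → ℝ) (hc : Continuous h) (hp : ∀ x, 0 < Real.cos (h x)) (a b : ℝ) :
    h b - h a < Real.pi := by
  by_contra hh
  push Not at hh
  have : h a + Real.pi ∈ range h := by
    have hpre := isPreconnected_range hc
    exact hpre.ordConnected.out (mem_range_self a) (mem_range_self b)
      ⟨by linarith [Real.pi_pos], by linarith⟩
  obtain ⟨c, hcc⟩ := this
  have h1 := hp c
  rw [hcc, Real.cos_add_pi] at h1
  linarith [hp a]

theorem pos_right {a b : ℝ} (h : 0 < a * b) (ha : 0 ≤ a) : 0 < b := by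
  by_contra hb
  push Not at hb
  exact absurd h (not_lt.2 (mul_nonpos_of_nonneg_of_nonpos ha hb))

theorem polar_re (z : ℂ) (t : ℝ) (h : z = ‖z‖ * Complex.exp (t * Complex.I)) :
    z.re = ‖z‖ * Real.cos t := by
  conv_lhs => rw [h]
  rw [Complex.re_ofReal_mul, Complex.exp_ofReal_mul_I_re]

theorem polar_im (z : ℂ) (t : ℝ) (h : z = ‖z‖ * Complex.exp (t * Complex.I)) :
    z.im = ‖z‖ * Real.sin t := by
  conv_lhs => rw [h]
  rw [Complex.im_ofReal_mul, Complex.exp_ofReal_mul_I_im]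

theorem exp_eq_of_polar {z w : ℂ} {s t : ℝ} (h0 : z ≠ 0) (hz : z = ‖z‖ * Complex.exp (s * Complex.I))
    (hw : w = ‖w‖ * Complex.exp (t * Complex.I)) (h : z = w) :
    ∃ m : ℤ, s = t + m * (2 * Real.pi) := by
  subst h
  rw [← Circle.exp_eq_exp]
  ext
  rw [Circle.coe_exp, Circle.coe_exp]
  have hn : (‖z‖ : ℂ) ≠ 0 := by simpa using h0
  exact mul_left_cancel₀ hn (hz.symm.trans hw)

/-- No nowhere zero odd function positive at the top boundary. -/
theorem no_odd (F : ℝ × ℝ → ℂ) (hF : Continuous F) (h0 : ∀ p, F p ≠ 0)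
    (hodd : ∀ x y, F (x + Real.pi, -y) = - F (x, y)) (htop : ∀ x, 0 < (F (x, 1)).re) : False := by
  obtain ⟨θ, hθ, h⟩ := angle_lift F hF h0
  obtain ⟨m, hm⟩ := int_const (A := ℝ × ℝ)
    (fun p => (θ (p.1 + Real.pi, -p.2) - θ p - Real.pi) / (2 * Real.pi)) (by fun_prop) (by
      intro p
      have h2 : -F p = ‖-F p‖ * Complex.exp ((θ p + Real.pi : ℝ) * Complex.I) := by
        rw [norm_neg]
        push_cast
        rw [add_mul, Complex.exp_add, Complex.exp_pi_mul_I]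
        conv_lhs => rw [h p]
        ring
      obtain ⟨m, hm⟩ := exp_eq_of_polar (h0 _) (h (p.1 + Real.pi, -p.2)) h2 (hodd p.1 p.2)
      refine ⟨m, ?_⟩
      rw [hm]
      field_simp [Real.pi_ne_zero]
      ring)
  have hm' : ∀ p : ℝ × ℝ, θ (p.1 + Real.pi, -p.2) = θ p + Real.pi + m * (2 * Real.pi) := by
    intro p
    have := hm p
    rw [div_eq_iff (by positivity)] at this
    linarith
  have hcos : ∀ x, 0 < Real.cos (θ (x, 1)) := by
    intro x
    have h1 := htop x
    rw [polar_re _ _ (h (x, 1))] at h1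
    exact pos_right h1 (norm_nonneg _)
  have e1 := hm' (0, 1)
  have e2 := hm' (0 + Real.pi, -1)
  have c1 := cos_pos_close (fun x => θ (x, 1)) (by fun_prop) hcos 0 (0 + Real.pi + Real.pi)
  have c2 := cos_pos_close (fun x => θ (x, 1)) (by fun_prop) hcos (0 + Real.pi + Real.pi) 0
  simp only [neg_neg] at e1 e2 c1 c2
  have hpi := Real.pi_pos
  rw [e2, e1] at c1 c2
  have d1 : (4 * m + 1 : ℝ) * Real.pi < 0 := by linarith
  have d2 : 0 < (4 * m + 3 : ℝ) * Real.pi := by linarith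
  have d1' : (4 * m + 1 : ℝ) < 0 := by
    by_contra hh; push Not at hh; nlinarith
  have d2' : 0 < (4 * m + 3 : ℝ) := pos_right (a := Real.pi) (by linarith) hpi.le
  have d3 : 4 * m + 1 < 0 := by exact_mod_cast d1'
  have d4 : 0 < 4 * m + 3 := by exact_mod_cast d2'
  omega

theorem parity_aux (θ : ℝ → ℝ) (hθ : Continuous θ) (T : ℝ) (m : ℤ)
    (hm : θ T + θ 0 = m * (2 * Real.pi)) (hc : ∀ t, 0 < Real.cos (θ t)) : Even m := by
  have c1 := cos_pos_close θ hθ hc 0 T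
  have c2 := cos_pos_close θ hθ hc T 0
  by_contra hodd
  rw [Int.not_even_iff_odd] at hodd
  obtain ⟨k, rfl⟩ := hodd
  have h1 := hc 0
  have : θ 0 = (θ 0 - θ T) / 2 + Real.pi + k * (2 * Real.pi) := by push_cast at hm; linarith
  rw [this, Real.cos_add_int_mul_two_pi, Real.cos_add_pi] at h1
  have : 0 < Real.cos ((θ 0 - θ T) / 2) := Real.cos_pos_of_mem_Ioo ⟨by linarith, by linarith⟩
  linarith

theorem no_conj (G : ℝ × ℝ → ℂ) (hG : Continuous G) (h0 : ∀ p, G p ≠ 0) (T N : ℝ)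
    (hconj : ∀ t u, G (t + T, u) = (starRingEnd ℂ) (G (t, u)))
    (htop : ∀ t, 0 < (G (t, N)).re) (hbot : ∀ t, (G (t, -N)).re < 0) : False := by
  obtain ⟨θ, hθ, h⟩ := angle_lift G hG h0
  obtain ⟨m, hm⟩ := int_const (A := ℝ × ℝ)
    (fun p => (θ (p.1 + T, p.2) + θ p) / (2 * Real.pi)) (by fun_prop) (by
      intro p
      have h2 : (starRingEnd ℂ) (G p) = ‖(starRingEnd ℂ) (G p)‖ *
          Complex.exp ((- θ p : ℝ) * Complex.I) := by
        rw [Complex.norm_conj]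
        conv_lhs => rw [h p]
        rw [map_mul, ← Complex.exp_conj]
        simp
      obtain ⟨m, hm⟩ := exp_eq_of_polar (h0 _) (h (p.1 + T, p.2)) h2 (hconj p.1 p.2)
      refine ⟨m, ?_⟩
      rw [hm]
      field_simp [Real.pi_ne_zero]
      ring)
  have hm' : ∀ p : ℝ × ℝ, θ (p.1 + T, p.2) + θ p = m * (2 * Real.pi) := by
    intro p
    have := hm p
    rwa [div_eq_iff (by positivity)] at this
  have ht : ∀ t, 0 < Real.cos (θ (t, N)) := by
    intro x
    have h1 := htop x
    rw [polar_re _ _ (h (x, N))] at h1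
    exact pos_right h1 (norm_nonneg _)
  have hb : ∀ t, 0 < Real.cos (θ (t, -N) + Real.pi) := by
    intro x
    have h1 := hbot x
    rw [polar_re _ _ (h (x, -N))] at h1
    rw [Real.cos_add_pi]
    have h2 : 0 < ‖G (x, -N)‖ * (-Real.cos (θ (x, -N))) := by linarith
    exact pos_right h2 (norm_nonneg _)
  have p1 := parity_aux (fun t => θ (t, N)) (by fun_prop) T m
    (by have := hm' (0, N); simpa using this) ht
  have p2 := parity_aux (fun t => θ (t, -N) + Real.pi) (by fun_prop) T (m + 1)
    (by have := hm' (0, -N); push_cast; simp only [zero_add] at this; linarith) hb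
  rw [Int.even_add_one] at p2
  exact p2 p1

end MobArc


namespace MobArc

noncomputable def phi : MobiusBand → Circle × ℂ :=
  Quot.lift (fun p : MobSq => (Circle.exp (2 * Real.pi * p.1),
    ((p.2 : ℝ) : ℂ) * (Circle.exp (Real.pi * p.1) : ℂ))) (by
    rintro ⟨x, y⟩ ⟨x', y'⟩ ⟨h1, h2, h3⟩
    simp only at h1 h2 h3
    simp only [h1, h2, h3]
    refine Prod.ext ?_ ?_
    · simp
    · simp [Circle.coe_exp])

theorem phi_mk (p : MobSq) : phi (Quot.mk mobRel p) = (Circle.exp (2 * Real.pi * p.1),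
    ((p.2 : ℝ) : ℂ) * (Circle.exp (Real.pi * p.1) : ℂ)) := rfl

theorem phi_cont : Continuous phi := by
  have hc : Continuous (fun w : Circle => (w : ℂ)) := continuous_subtype_val
  have he : Continuous (fun t : ℝ => Circle.exp t) := Circle.exp.continuous
  refine continuous_quot_lift _ ?_
  fun_prop

noncomputable def psi (p : Circle × ℝ) : Circle × ℂ := (p.1 * p.1, (p.2 : ℂ) * (p.1 : ℂ))

theorem psi_cont : Continuous psi := by
  have : Continuous (fun w : Circle => (w : ℂ)) := continuous_subtype_val
  unfold psi
  fun_prop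

theorem psi_neg (p : Circle × ℝ) : psi (-p) = psi p := by
  simp [psi]

theorem psi_eq {p q : Circle × ℝ} : psi p = psi q ↔ p = q ∨ p = -q := by
  constructor
  · intro h
    obtain ⟨w, y⟩ := p
    obtain ⟨w', y'⟩ := q
    simp only [psi, Prod.mk.injEq] at h
    obtain ⟨h1, h2⟩ := h
    have h1' : (w : ℂ) * w = w' * w' := by
      have := congrArg (fun z : Circle => (z : ℂ)) h1
      simpa using this
    have hw' := w'.coe_ne_zero
    rcases mul_self_eq_mul_self_iff.1 h1' with h | h
    · left
      rw [h] at h2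
      have := mul_right_cancel₀ hw' h2
      exact Prod.ext (Circle.ext h) (by exact_mod_cast this)
    · right
      rw [h] at h2
      have h3 : (-(y : ℂ)) * w' = y' * w' := by linear_combination h2
      have := mul_right_cancel₀ hw' h3
      have h4 : -y = y' := by exact_mod_cast this
      exact Prod.ext (Circle.ext (by simpa using h)) (by simp [← h4])
  · rintro (rfl | rfl)
    · rfl
    · exact psi_neg q

theorem phi_inj : Function.Injective phi := by
  intro a b
  induction a using Quot.ind with | mk p => ?_
  induction b using Quot.ind with | mk q => ?_
  intro h
  rw [phi_mk, phi_mk, Prod.mk.injEq] at h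
  obtain ⟨h1, h2⟩ := h
  obtain ⟨⟨x, hx⟩, ⟨y, hy⟩⟩ := p
  obtain ⟨⟨x', hx'⟩, ⟨y', hy'⟩⟩ := q
  simp only at h1 h2
  rw [Circle.exp_eq_exp] at h1
  obtain ⟨m, hm⟩ := h1
  have hpi := Real.pi_pos
  have hm' : x = x' + m := by
    have : 2 * Real.pi * x = 2 * Real.pi * (x' + m) := by rw [hm]; ring
    exact mul_left_cancel₀ (by positivity) this
  have hm1 : (m : ℝ) ≤ 1 := by linarith [hx.1, hx.2, hx'.1, hx'.2]
  have hm2 : (-1 : ℝ) ≤ m := by linarith [hx.1, hx.2, hx'.1, hx'.2]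
  have hm1' : m ≤ 1 := by exact_mod_cast hm1
  have hm2' : -1 ≤ m := by exact_mod_cast hm2
  have : m = -1 ∨ m = 0 ∨ m = 1 := by omega
  rcases this with rfl | rfl | rfl
  · have e1 : x = 0 := by push_cast at hm'; linarith [hx.1, hx'.2]
    have e2 : x' = 1 := by push_cast at hm'; linarith [hx.1, hx'.2]
    subst e1 e2
    refine Quot.sound ⟨rfl, rfl, ?_⟩
    simp [Circle.coe_exp] at h2
    have h3 : (y : ℂ) = ((-y' : ℝ) : ℂ) := by rw [h2]; simp
    have h4 : y = -y' := by exact_mod_cast h3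
    simp [h4]
  · have e1 : x = x' := by simpa using hm'
    subst e1
    have := mul_right_cancel₀ (Circle.coe_ne_zero _) h2
    have h4 : y = y' := by exact_mod_cast this
    subst h4
    rfl
  · have e1 : x = 1 := by push_cast at hm'; linarith [hx.2, hx'.1]
    have e2 : x' = 0 := by push_cast at hm'; linarith [hx.2, hx'.1]
    subst e1 e2
    refine (Quot.sound ⟨rfl, rfl, ?_⟩).symm
    simp [Circle.coe_exp] at h2
    have h3 : ((-y : ℝ) : ℂ) = (y' : ℂ) := by rw [← h2]; simp
    have h4 : -y = y' := by exact_mod_cast h3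
    simp [← h4]

instance : CompactSpace MobiusBand := inferInstanceAs (CompactSpace (Quot _))

instance : T2Space MobiusBand := T2Space.of_injective_continuous phi_inj phi_cont

theorem phi_emb : Topology.IsClosedEmbedding phi := phi_cont.isClosedEmbedding phi_inj

theorem phi_lift (m : MobiusBand) : ∃ p : Circle × ℝ, |p.2| ≤ 1 ∧ psi p = phi m := by
  induction m using Quot.ind with | mk p => ?_
  refine ⟨(Circle.exp (Real.pi * p.1), p.2), abs_le.2 p.2.2, ?_⟩
  rw [phi_mk, psi, ← Circle.exp_add]
  congr 2; ring

theorem phi_of_psi (p : Circle × ℝ) (hp : |p.2| ≤ 1) : ∃ m, phi m = psi p := by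
  obtain ⟨w, y⟩ := p
  obtain ⟨a, ha⟩ := Circle.exp_surjective w
  have hpi := Real.pi_pos
  have key : ∀ q : Circle × ℝ, |q.2| ≤ 1 → (∃ x : ℝ, x ∈ Icc (0:ℝ) 1 ∧ q.1 = Circle.exp (Real.pi * x)) →
      ∃ m, phi m = psi q := by
    rintro ⟨w, y⟩ hq ⟨x, hx, hw⟩
    refine ⟨Quot.mk _ (⟨x, hx⟩, ⟨y, abs_le.1 hq⟩), ?_⟩
    simp only at hw
    rw [phi_mk, psi, hw, ← Circle.exp_add]
    congr 2; simp only; ring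
  let n := ⌊a / Real.pi⌋
  have hx : a / Real.pi - n ∈ Icc (0:ℝ) 1 := ⟨Int.fract_nonneg _, (Int.fract_lt_one _).le⟩
  have hexp : Circle.exp (Real.pi * (a / Real.pi - n)) = w ∨
      Circle.exp (Real.pi * (a / Real.pi - n)) = -w := by
    have h1 : Real.pi * (a / Real.pi - n) = a - n * Real.pi := by field_simp
    rw [h1, ← ha]
    rcases Int.even_or_odd' n with ⟨k, hk | hk⟩
    · left
      rw [Circle.exp_eq_exp]
      refine ⟨-k, ?_⟩
      rw [hk]; push_cast; ring
    · right
      have h2 : a - n * Real.pi = a + Real.pi + (-(k+1) : ℤ) * (2 * Real.pi) := by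
        rw [hk]; push_cast; ring
      rw [h2]
      ext
      rw [Circle.coe_neg, Circle.exp_eq_exp.2 ⟨_, rfl⟩]
      simp [Circle.coe_exp, add_mul, Complex.exp_add]
  rcases hexp with h | h
  · exact key _ hp ⟨_, hx, h.symm⟩
  · obtain ⟨m, hm⟩ := key (-(w, y)) (by simpa using hp) ⟨_, hx, h.symm⟩
    exact ⟨m, by rw [hm, psi_neg]⟩

theorem bdry_iff {m : MobiusBand} {p : Circle × ℝ} (h : phi m = psi p) :
    m ∈ mobBdry ↔ |p.2| = 1 := by
  have key : ∀ q : MobSq, phi (Quot.mk mobRel q) = psi p → |(q.2 : ℝ)| = |p.2| := by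
    intro q hq
    have h1 := congrArg (fun z : Circle × ℂ => ‖z.2‖) hq
    simpa only [phi_mk, psi, norm_mul, Circle.norm_coe, Complex.norm_real, mul_one, Real.norm_eq_abs] using h1
  constructor
  · rintro ⟨q, rfl, hq⟩
    rw [← key q h, hq]
  · intro hp
    induction m using Quot.ind with | mk q => ?_
    exact ⟨q, rfl, by rw [key q h, hp]⟩

noncomputable def clamp (y : ℝ) : ℝ := max (-1) (min 1 y)

theorem clamp_cont : Continuous clamp := by unfold clamp; fun_prop

theorem clamp_abs (y : ℝ) : |clamp y| ≤ 1 := by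
  unfold clamp
  rw [abs_le]
  constructor
  · exact le_max_left _ _
  · exact max_le (by norm_num) (min_le_left _ _)

theorem clamp_of {y : ℝ} (h : |y| ≤ 1) : clamp y = y := by
  rw [abs_le] at h
  unfold clamp
  rw [min_eq_right h.2, max_eq_right h.1]

theorem clamp_neg (y : ℝ) : clamp (-y) = - clamp y := by
  unfold clamp
  rcases le_total y 1 with h1 | h1 <;> rcases le_total y (-1) with h2 | h2
  · rw [min_eq_right h1, max_eq_left h2, min_eq_left (by linarith), max_eq_right (by linarith)]; simp
  · rw [min_eq_right h1, max_eq_right h2, min_eq_right (by linarith), max_eq_right (by linarith)]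
  · linarith
  · have e1 : min 1 y = 1 := min_eq_left h1
    have e2 : min 1 (-y) = -y := min_eq_right (by linarith)
    have e3 : max (-1) (-y) = -1 := max_eq_left (by linarith)
    rw [e1, e2, e3, max_eq_right (by norm_num)]

theorem exists_proj (p : Circle × ℝ) : ∃ m, phi m = psi (p.1, clamp p.2) :=
  phi_of_psi _ (clamp_abs _)

noncomputable def proj (p : Circle × ℝ) : MobiusBand := (exists_proj p).choose

theorem phi_proj' (p : Circle × ℝ) : phi (proj p) = psi (p.1, clamp p.2) :=
  (exists_proj p).choose_spec

theorem phi_proj {p : Circle × ℝ} (h : |p.2| ≤ 1) : phi (proj p) = psi p := by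
  rw [phi_proj', clamp_of h]

theorem proj_cont : Continuous proj := by
  rw [phi_emb.isEmbedding.continuous_iff]
  have : phi ∘ proj = fun p => psi (p.1, clamp p.2) := funext phi_proj'
  rw [this]
  exact psi_cont.comp (by have := clamp_cont; fun_prop)

theorem proj_neg (p : Circle × ℝ) : proj (-p) = proj p := by
  apply phi_inj
  rw [phi_proj', phi_proj', ← psi_neg]
  simp [clamp_neg]

theorem proj_eq {p q : Circle × ℝ} (hp : |p.2| ≤ 1) (hq : |q.2| ≤ 1) :
    proj p = proj q ↔ p = q ∨ p = -q := by
  rw [← psi_eq, ← phi_proj hp, ← phi_proj hq, phi_inj.eq_iff]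

theorem proj_surj (m : MobiusBand) : ∃ p : Circle × ℝ, |p.2| ≤ 1 ∧ proj p = m := by
  obtain ⟨p, hp, h⟩ := phi_lift m
  exact ⟨p, hp, phi_inj (by rw [phi_proj hp, h])⟩

theorem proj_bdry {p : Circle × ℝ} (hp : |p.2| ≤ 1) : proj p ∈ mobBdry ↔ |p.2| = 1 :=
  bdry_iff (phi_proj hp)

/-- Lifting maps from simply connected spaces. -/
theorem mob_lift {A : Type*} [TopologicalSpace A] [SimplyConnectedSpace A]
    [LocallyPathConnectedSpace A] (f : A → MobiusBand) (hf : Continuous f) :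
    ∃ α y : A → ℝ, Continuous α ∧ Continuous y ∧ (∀ a, |y a| ≤ 1) ∧
      ∀ a, proj (Circle.exp (α a), y a) = f a := by
  obtain ⟨β, hβ, hβe⟩ := circle_lift (fun a => (phi (f a)).1) ((phi_cont.comp hf).fst)
  have hsec : ∀ a, ∃ y : ℝ, |y| ≤ 1 ∧ psi (Circle.exp (β a / 2), y) = phi (f a) := by
    intro a
    obtain ⟨p, hp, h⟩ := phi_lift (f a)
    have h1 : Circle.exp (β a / 2) * Circle.exp (β a / 2) = p.1 * p.1 := by
      rw [← Circle.exp_add, add_halves, hβe, ← h]; rfl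
    have h2 : psi (Circle.exp (β a / 2), 0) = psi (p.1, 0) := by
      simp [psi, h1]
    rcases psi_eq.1 h2 with h3 | h3
    · rw [Prod.mk.injEq] at h3
      refine ⟨p.2, hp, ?_⟩
      rw [h3.1, ← h]
    · simp only [Prod.neg_mk, Prod.mk.injEq] at h3
      refine ⟨-p.2, by simpa using hp, ?_⟩
      rw [h3.1, ← h, ← psi_neg p]; rfl
  choose y hy hy' using hsec
  have hyc : y = fun a => ((phi (f a)).2 / (Circle.exp (β a / 2) : ℂ)).re := by
    ext a
    rw [← hy' a]
    simp [psi]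
  refine ⟨fun a => β a / 2, y, by fun_prop, ?_, hy, ?_⟩
  · rw [hyc]
    refine Complex.continuous_re.comp ((phi_cont.comp hf).snd.div ?_ (fun a => Circle.coe_ne_zero _))
    exact continuous_subtype_val.comp (Circle.exp.continuous.comp (by fun_prop))
  · intro a
    apply phi_inj
    rw [phi_proj (hy a), hy']

end MobArc

namespace MobArc

theorem exp_shift (a : ℝ) (n : ℤ) : ((Circle.exp (a + n * Real.pi) : Circle) : ℂ) =
    (-1 : ℂ) ^ n * (Circle.exp a : ℂ) := by
  rcases Int.even_or_odd' n with ⟨k, hk | hk⟩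
  · have h2 : a + n * Real.pi = a + (k : ℤ) * (2 * Real.pi) := by rw [hk]; push_cast; ring
    rw [h2, Circle.exp_eq_exp.2 ⟨_, rfl⟩, Even.neg_one_zpow ⟨k, by omega⟩, one_mul]
  · have h2 : a + n * Real.pi = a + Real.pi + (k : ℤ) * (2 * Real.pi) := by
      rw [hk]; push_cast; ring
    rw [h2, Circle.exp_eq_exp.2 ⟨_, rfl⟩, Odd.neg_one_zpow ⟨k, by omega⟩]
    simp [Circle.coe_exp]

theorem strip_eq {a b a' b' : ℝ} (hb : |b| ≤ 1) (hb' : |b'| ≤ 1) :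
    proj (Circle.exp a, b) = proj (Circle.exp a', b') ↔
      ∃ n : ℤ, a = a' + n * Real.pi ∧ b = (-1) ^ n * b' := by
  rw [proj_eq hb hb']
  constructor
  · rintro (h | h)
    · rw [Prod.mk.injEq, Circle.exp_eq_exp] at h
      obtain ⟨⟨m, hm⟩, h2⟩ := h
      refine ⟨2 * m, by rw [hm]; push_cast; ring, ?_⟩
      rw [Even.neg_one_zpow ⟨m, by omega⟩, h2, one_mul]
    · rw [Prod.neg_mk, Prod.mk.injEq] at h
      have h1 : Circle.exp (a' + (1 : ℤ) * Real.pi) = - Circle.exp a' := by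
        ext; rw [exp_shift]; simp
      rw [← h1, Circle.exp_eq_exp] at h
      obtain ⟨⟨m, hm⟩, h2⟩ := h
      refine ⟨2 * m + 1, by rw [hm]; push_cast; ring, ?_⟩
      rw [Odd.neg_one_zpow ⟨m, by omega⟩, h2]; ring
  · rintro ⟨n, rfl, rfl⟩
    rcases Int.even_or_odd n with hn | hn
    · left
      refine Prod.ext (Circle.ext ?_) ?_
      · simp only; rw [exp_shift, hn.neg_one_zpow, one_mul]
      · simp [hn.neg_one_zpow]
    · right
      refine Prod.ext (Circle.ext ?_) ?_
      · simp only [Prod.neg_mk]; rw [exp_shift, hn.neg_one_zpow]; simp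
      · simp [hn.neg_one_zpow]

theorem shift_alpha {α : ℝ → ℝ} {T c : ℝ} (h : ∀ s, α (s + T) = α s + c) (s : ℝ) (j : ℤ) :
    α (s + j * T) = α s + j * c := by
  induction j using Int.induction_on with
  | zero => simp
  | succ i ih =>
    have : s + ((i : ℤ) + 1 : ℤ) * T = (s + (i : ℤ) * T) + T := by push_cast; ring
    rw [this, h, ih]; push_cast; ring
  | pred i ih =>
    have h1 := h (s + (-(i : ℤ) - 1 : ℤ) * T)
    have : s + (-(i : ℤ) - 1 : ℤ) * T + T = (s + (-(i : ℤ) : ℤ) * T) := by push_cast; ring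
    rw [this, ih] at h1
    push_cast at *; linarith

theorem shift_y {y : ℝ → ℝ} {T : ℝ} (h : ∀ s, y (s + T) = - y s) (s : ℝ) (j : ℤ) :
    y (s + j * T) = (-1) ^ j * y s := by
  induction j using Int.induction_on with
  | zero => simp
  | succ i ih =>
    have : s + ((i : ℤ) + 1 : ℤ) * T = (s + (i : ℤ) * T) + T := by push_cast; ring
    rw [this, h, ih, zpow_add₀ (by norm_num)]; simp
  | pred i ih =>
    have h1 := h (s + (-(i : ℤ) - 1 : ℤ) * T)
    have : s + (-(i : ℤ) - 1 : ℤ) * T + T = (s + (-(i : ℤ) : ℤ) * T) := by push_cast; ring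
    rw [this, ih] at h1
    rw [zpow_sub₀ (by norm_num)]; simp at *; linarith

theorem bounded_of_periodic (b : ℝ → ℝ) (hb : Continuous b) (T : ℝ) (hT : 0 < T)
    (h : ∀ s, b (s + T) = b s) : ∃ B, ∀ s, |b s| ≤ B := by
  obtain ⟨B, hB⟩ := isCompact_Icc.exists_bound_of_continuousOn (s := Icc (0:ℝ) T) hb.continuousOn
  refine ⟨B, fun s => ?_⟩
  obtain ⟨t, ht, h2⟩ := (show Function.Periodic b T from h).exists_mem_Ico₀ hT s
  rw [h2]
  exact hB t ⟨ht.1, ht.2.le⟩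

theorem step_one (γ : Circle → MobiusBand) (hinj : Function.Injective γ) (α y : ℝ → ℝ)
    (hα : Continuous α) (hy : Continuous y) (hy1 : ∀ s, |y s| ≤ 1)
    (hl : ∀ s, proj (Circle.exp (α s), y s) = γ (Circle.exp s)) (k : ℤ) (hk : Odd k)
    (hαp : ∀ s, α (s + 2 * Real.pi) = α s + k * Real.pi)
    (hyp : ∀ s, y (s + 2 * Real.pi) = - y s) : k * k = 1 := by
  by_contra hkk
  have hpi := Real.pi_pos
  obtain ⟨B, hB⟩ := bounded_of_periodic (fun s => α s - k * s / 2) (by fun_prop) (2 * Real.pi)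
    (by positivity) (by intro s; simp only [hαp]; ring)
  have hB0 : 0 ≤ B := (abs_nonneg _).trans (hB 0)
  have hk0 : k ≠ 0 := by rintro rfl; simp at hk
  have hk1 : (1 : ℝ) ≤ (k : ℝ) * k := by
    have : 1 ≤ k * k := by have := mul_self_pos.2 hk0; omega
    exact_mod_cast this
  let N : ℝ := 4 * B + 2 * Real.pi + 1
  have hN : N ≤ (k : ℝ) * k * N := by
    have : 0 ≤ N := by positivity
    nlinarith
  refine no_conj (fun p => ⟨α (p.1 + k * p.2) - α p.1 - Real.pi, y (p.1 + k * p.2) + y p.1⟩) ?_ ?_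
    (2 * Real.pi) N ?_ ?_ ?_
  · have : (fun p : ℝ × ℝ => (⟨α (p.1 + k * p.2) - α p.1 - Real.pi, y (p.1 + k * p.2) + y p.1⟩ : ℂ))
      = fun p => Complex.equivRealProdCLM.symm (α (p.1 + k * p.2) - α p.1 - Real.pi, y (p.1 + k * p.2) + y p.1) := by
      funext p; rfl
    rw [this]
    exact Complex.equivRealProdCLM.symm.continuous.comp (by fun_prop)
  · rintro ⟨s, u⟩ h0
    rw [Complex.ext_iff] at h0
    simp only [Complex.zero_re, Complex.zero_im] at h0
    have h1 : proj (Circle.exp (α (s + k * u)), y (s + k * u)) = proj (Circle.exp (α s), y s) :=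
      (strip_eq (hy1 _) (hy1 _)).2 ⟨1, by push_cast; linarith, by rw [zpow_one]; linarith⟩
    rw [hl, hl] at h1
    obtain ⟨m, hm⟩ := Circle.exp_eq_exp.1 (hinj h1)
    have h2 := shift_alpha hαp s m
    rw [← hm] at h2
    have h3 : ((m * k : ℤ) : ℝ) * Real.pi = 1 * Real.pi := by push_cast; linarith
    have h4 : m * k = 1 := by exact_mod_cast mul_right_cancel₀ hpi.ne' h3
    rcases Int.isUnit_iff.1 (IsUnit.of_mul_eq_one_right _ h4) with h | h <;> rw [h] at hkk <;> simp at hkk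
  · intro t u
    apply Complex.ext
    · simp only [Complex.conj_re]
      rw [show t + 2 * Real.pi + k * u = t + k * u + 2 * Real.pi by ring, hαp, hαp]; ring
    · simp only [Complex.conj_im]
      rw [show t + 2 * Real.pi + k * u = t + k * u + 2 * Real.pi by ring, hyp, hyp]; ring
  · intro t
    have h1 := abs_le.1 (hB t)
    have h2 := abs_le.1 (hB (t + k * N))
    show 0 < α (t + k * N) - α t - Real.pi
    have : (k : ℝ) * (t + k * N) / 2 = k * t / 2 + (k * k * N) / 2 := by ring
    have hN' : N = 4 * B + 2 * Real.pi + 1 := rfl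
    linarith [h1.1, h1.2, h2.1, h2.2]
  · intro t
    have h1 := abs_le.1 (hB t)
    have h2 := abs_le.1 (hB (t + k * (-N)))
    show α (t + k * (-N)) - α t - Real.pi < 0
    have : (k : ℝ) * (t + k * (-N)) / 2 = k * t / 2 - (k * k * N) / 2 := by ring
    have hN' : N = 4 * B + 2 * Real.pi + 1 := rfl
    linarith [h1.1, h1.2, h2.1, h2.2]

end MobArc

namespace MobArc

theorem circle_descend (b : ℝ → ℝ) (hb : Continuous b) (h : ∀ s, b (s + 2 * Real.pi) = b s) :
    ∃ φ : C(Circle, ℝ), ∀ s, φ (Circle.exp s) = b s := by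
  have hq : Topology.IsQuotientMap (Circle.exp : ℝ → Circle) :=
    Circle.isCoveringMap_exp.isLocalHomeomorph.isOpenMap.isQuotientMap Circle.exp.continuous
      Circle.exp_surjective
  have hfac : Function.FactorsThrough (⟨b, hb⟩ : C(ℝ, ℝ)) (Circle.exp : ℝ → Circle) := by
    intro s t hst
    obtain ⟨m, hm⟩ := Circle.exp_eq_exp.1 hst
    have := shift_alpha (c := 0) (by simpa using h) t m
    simp only [ContinuousMap.coe_mk]
    rw [hm, this]; simp
  refine ⟨hq.lift ⟨b, hb⟩ hfac, fun s => ?_⟩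
  exact congrArg (fun g : C(ℝ, ℝ) => g s) (hq.lift_comp (f := Circle.exp) ⟨b, hb⟩ hfac)

theorem step_two (γ : Circle → MobiusBand) (hγ : Topology.IsEmbedding γ) (α y : ℝ → ℝ)
    (hα : Continuous α) (hy : Continuous y) (hy1 : ∀ s, |y s| ≤ 1)
    (hl : ∀ s, proj (Circle.exp (α s), y s) = γ (Circle.exp s)) (k : ℤ) (hk : Odd k)
    (hkk : k * k = 1)
    (hαp : ∀ s, α (s + 2 * Real.pi) = α s + k * Real.pi)
    (hyp : ∀ s, y (s + 2 * Real.pi) = - y s) (U V : Set MobiusBand) (hU : IsOpen U) (hV : IsOpen V)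
    (hUV : Disjoint U V) (hc : U ∪ V = (range γ)ᶜ) (hbU : mobBdry ⊆ U) : V = ∅ := by
  classical
  by_contra hne
  obtain ⟨v, hv⟩ := nonempty_iff_ne_empty.2 hne
  obtain ⟨⟨w, y0⟩, hy0, hpv⟩ := proj_surj v
  obtain ⟨α0, rfl⟩ := Circle.exp_surjective w
  simp only at hy0
  have hkR : (k : ℝ) * k = 1 := by exact_mod_cast hkk
  have hUVd : ∀ x, x ∈ U → x ∈ V → False := fun x h1 h2 => disjoint_left.1 hUV h1 h2
  have hVr : ∀ z, γ z ∉ V := fun z hz => by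
    have : γ z ∈ (range γ)ᶜ := hc ▸ Or.inr hz
    exact this ⟨z, rfl⟩
  have hy0' : |y0| < 1 := by
    refine lt_of_le_of_ne hy0 fun h => ?_
    have := (proj_bdry (p := (Circle.exp α0, y0)) hy0).2 h
    rw [hpv] at this
    exact hUVd v (hbU this) hv
  have hpi := Real.pi_pos
  obtain ⟨φ0, hφ0⟩ := circle_descend (fun s => s - 2 * k * α s) (by fun_prop) (by
    intro s; simp only [hαp]
    linear_combination (-2 * Real.pi) * hkR)
  have hγc : Topology.IsClosedEmbedding γ := hγ.continuous.isClosedEmbedding hγ.injective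
  obtain ⟨φ, hφ⟩ := ContinuousMap.exists_extension' hγc φ0
  have hφ' : ∀ s, φ (γ (Circle.exp s)) = s - 2 * k * α s := fun s => by
    rw [← hφ0, ← hφ]; rfl
  let q : ℝ × ℝ → MobiusBand := fun p => proj (Circle.exp p.1, p.2)
  have hq : Continuous q := proj_cont.comp (by
    have := Circle.exp.continuous
    exact (this.comp continuous_fst).prodMk continuous_snd)
  let σ : ℝ × ℝ → ℝ := fun p => 2 * k * p.1 + φ (q p)
  have hσ : Continuous σ := by
    have := φ.continuous
    fun_prop
  let H : ℝ × ℝ → ℝ × ℝ := fun p => if q p ∈ V then (α (σ p), y (σ p)) else (p.1, clamp p.2)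
  have hqc : ∀ p, q p = proj (Circle.exp p.1, clamp p.2) := fun p => by
    apply phi_inj
    rw [phi_proj', phi_proj']
    simp only [clamp_of (clamp_abs _)]
  have hH : Continuous H := by
    refine Continuous.if ?_ (by fun_prop) (by have := clamp_cont; fun_prop)
    intro p hp
    have hop : IsOpen {x | q x ∈ V} := hV.preimage hq
    rw [hop.frontier_eq] at hp
    have h1 : q p ∉ U := by
      intro hpU
      obtain ⟨x, hx1, hx2⟩ := mem_closure_iff.1 hp.1 _ (hU.preimage hq) hpU
      exact hUVd _ hx1 hx2
    have h2 : q p ∈ range γ := by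
      by_contra h
      have : q p ∈ U ∪ V := hc ▸ h
      exact this.elim h1 hp.2
    obtain ⟨z, hz⟩ := h2
    obtain ⟨s, rfl⟩ := Circle.exp_surjective z
    have h3 := hz
    rw [← hl, hqc] at h3
    obtain ⟨n, hn1, hn2⟩ := (strip_eq (clamp_abs _) (hy1 _)).1 h3.symm
    have hkn : (-1 : ℝ) ^ (k * n) = (-1) ^ n := by rw [zpow_mul, hk.neg_one_zpow]
    have e1 := shift_alpha hαp s (k * n)
    have e2 := shift_y hyp s (k * n)
    rw [hkn, ← hn2] at e2
    have e3 : α (s + (k * n : ℤ) * (2 * Real.pi)) = p.1 := by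
      rw [e1, hn1]; push_cast; linear_combination (n * Real.pi) * hkR
    have e4 : σ p = s + (k * n : ℤ) * (2 * Real.pi) := by
      show 2 * k * p.1 + φ (q p) = _
      rw [← hz, ← Circle.exp_eq_exp.2 ⟨k * n, rfl⟩, hφ', e3]; ring
    rw [e4, e2, e3]
  have hqodd : ∀ a b, q (a + Real.pi, -b) = q (a, b) := by
    intro a b
    rw [hqc, hqc, strip_eq (clamp_abs _) (clamp_abs _)]
    exact ⟨1, by simp, by simp [clamp_neg]⟩
  have hHodd : ∀ a b, H (a + Real.pi, -b) = ((H (a, b)).1 + Real.pi, -(H (a, b)).2) := by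
    intro a b
    simp only [H, hqodd]
    split_ifs
    · have : σ (a + Real.pi, -b) = σ (a, b) + k * (2 * Real.pi) := by
        simp only [σ, hqodd]; ring
      rw [this, shift_alpha hαp, shift_y hyp, hk.neg_one_zpow]
      refine Prod.ext ?_ ?_
      · simp only; linear_combination Real.pi * hkR
      · simp
    · simp [clamp_neg]
  have hHv : ∀ p, proj (Circle.exp (H p).1, (H p).2) ≠ v ∧ |(H p).2| ≤ 1 := by
    intro p
    simp only [H]
    split_ifs with h
    · simp only [hl]
      exact ⟨fun h => hVr _ (h ▸ hv), hy1 _⟩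
    · simp only [← hqc]
      exact ⟨fun h' => h (h' ▸ hv), clamp_abs _⟩
  refine no_odd (fun p => Complex.equivRealProdCLM.symm
    ((H p).2 - y0 * Real.cos ((H p).1 - α0), Real.sin ((H p).1 - α0))) ?_ ?_ ?_ ?_
  · exact Complex.equivRealProdCLM.symm.continuous.comp (by fun_prop)
  · intro p h0
    have h0' := (map_eq_zero_iff _ Complex.equivRealProdCLM.symm.injective).1 h0
    rw [Prod.mk_eq_zero] at h0'
    obtain ⟨n, hn⟩ := Real.sin_eq_zero_iff.1 h0'.2
    apply (hHv p).1
    rw [← hpv, strip_eq (hHv p).2 hy0]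
    refine ⟨n, by linarith, ?_⟩
    have := h0'.1
    rw [← hn, Real.cos_int_mul_pi] at this
    linarith
  · intro a b
    rw [hHodd, ← map_neg]
    congr 1
    rw [show (H (a, b)).1 + Real.pi - α0 = (H (a, b)).1 - α0 + Real.pi by ring, Real.cos_add_pi,
      Real.sin_add_pi]
    refine Prod.ext ?_ rfl
    simp only [Prod.fst_neg]; ring
  · intro x
    have h1 : q (x, 1) ∈ U := hbU ((proj_bdry (p := (Circle.exp x, 1)) (by simp)).2 (by simp))
    have h2 : q (x, 1) ∉ V := fun h => hUVd _ h1 h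
    have h3 : H (x, 1) = (x, 1) := by
      simp only [H, if_neg h2, clamp_of (show |(1:ℝ)| ≤ 1 by simp)]
    show 0 < (H (x, 1)).2 - y0 * Real.cos ((H (x, 1)).1 - α0)
    rw [h3]
    have h4 : |y0 * Real.cos (x - α0)| ≤ |y0| * 1 := by
      rw [abs_mul]; exact mul_le_mul_of_nonneg_left (Real.abs_cos_le_one _) (abs_nonneg _)
    have := le_abs_self (y0 * Real.cos (x - α0))
    simp only; linarith

theorem bdry_conn : IsPreconnected mobBdry := by
  have : mobBdry = range (fun x : ℝ => proj (Circle.exp x, 1)) := by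
    ext m
    constructor
    · intro hm
      obtain ⟨⟨w, b⟩, hb, rfl⟩ := proj_surj m
      obtain ⟨a, rfl⟩ := Circle.exp_surjective w
      have h1 := (proj_bdry hb).1 hm
      simp only at h1 hb
      rcases (abs_eq (by norm_num)).1 h1 with h | h
      · exact ⟨a, by rw [h]⟩
      · refine ⟨a + Real.pi, ?_⟩
        simp only
        rw [strip_eq (by simp) hb]
        exact ⟨1, by simp, by simp [h]⟩
    · rintro ⟨x, rfl⟩
      exact (proj_bdry (by simp)).2 (by simp)
  rw [this]
  apply isPreconnected_range
  exact proj_cont.comp (by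
    have := Circle.exp.continuous
    exact this.prodMk continuous_const)

theorem odd_core (γ : Circle → MobiusBand) (hγ : Topology.IsEmbedding γ)
    (hb : Disjoint (range γ) mobBdry) (α y : ℝ → ℝ)
    (hα : Continuous α) (hy : Continuous y) (hy1 : ∀ s, |y s| ≤ 1)
    (hl : ∀ s, proj (Circle.exp (α s), y s) = γ (Circle.exp s)) (k : ℤ) (hk : Odd k)
    (hαp : ∀ s, α (s + 2 * Real.pi) = α s + k * Real.pi)
    (hyp : ∀ s, y (s + 2 * Real.pi) = - y s) : IsConnected (range γ)ᶜ := by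
  have hkk := step_one γ hγ.injective α y hα hy hy1 hl k hk hαp hyp
  have hcl : IsClosed (range γ) := (hγ.continuous.isClosedEmbedding hγ.injective).isClosed_range
  have hbs : mobBdry ⊆ (range γ)ᶜ := fun x hx h => disjoint_left.1 hb h hx
  refine ⟨⟨proj (1, 1), hbs ((proj_bdry (by simp)).2 (by simp))⟩, ?_⟩
  rw [isPreconnected_iff_subset_of_disjoint]
  intro u v hu hv hcov hdis
  have key : ∀ u v : Set MobiusBand, IsOpen u → IsOpen v → (range γ)ᶜ ⊆ u ∪ v →
      (range γ)ᶜ ∩ (u ∩ v) = ∅ → mobBdry ⊆ u → (range γ)ᶜ ⊆ u := by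
    intro u v hu hv hcov hdis hbu
    have := step_two γ hγ α y hα hy hy1 hl k hk hkk hαp hyp (u ∩ (range γ)ᶜ) (v ∩ (range γ)ᶜ)
      (hu.inter hcl.isOpen_compl) (hv.inter hcl.isOpen_compl) (by
        rw [disjoint_left]
        rintro x ⟨h1, h2⟩ ⟨h3, -⟩
        have : x ∈ (range γ)ᶜ ∩ (u ∩ v) := ⟨h2, h1, h3⟩
        rw [hdis] at this; exact this)
      (by rw [← union_inter_distrib_right]; exact inter_eq_right.2 hcov) (subset_inter hbu hbs)
    intro x hx
    rcases hcov hx with h | h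
    · exact h
    · have : x ∈ v ∩ (range γ)ᶜ := ⟨h, hx⟩
      simp_all
  rcases isPreconnected_iff_subset_of_disjoint.1 bdry_conn u v hu hv (hbs.trans hcov)
    (subset_eq_empty (inter_subset_inter_left _ hbs) hdis) with h | h
  · exact Or.inl (key u v hu hv hcov hdis h)
  · exact Or.inr (key v u hv hu (by rwa [union_comm]) (by rwa [inter_comm v u]) h)

end MobArc

namespace MobArc

theorem exists_circle_rep (z : Circle) : ∃ t ∈ Ico (0:ℝ) (2 * Real.pi), Circle.exp t = z := by
  obtain ⟨a, rfl⟩ := Circle.exp_surjective z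
  obtain ⟨t, ht, h⟩ := Circle.periodic_exp.exists_mem_Ico₀ (by positivity : 0 < 2 * Real.pi) a
  exact ⟨t, ht, h.symm⟩

theorem isCoreCurve_of (γ : Circle → MobiusBand) (h1 : Topology.IsEmbedding γ)
    (h2 : Disjoint (range γ) mobBdry) (h3 : IsConnected (range γ)ᶜ) :
    ∃ γ' : ↥(Metric.sphere (0:ℂ) 1) → MobiusBand, IsCoreCurve γ' ∧ range γ' = range γ :=
  ⟨γ, ⟨h1, h2, h3⟩, rfl⟩

theorem loop_core (p : Circle × ℝ) (S : Set (Circle × ℝ)) (hS : IsArc S p (-p))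
    (hlt : ∀ x ∈ S, |x.2| < 1) (hsimp : ∀ x ∈ S, -x ∈ S → x = p ∨ x = -p) :
    ∃ γ : ↥(Metric.sphere (0:ℂ) 1) → MobiusBand, IsCoreCurve γ ∧ range γ ⊆ proj '' S := by
  have hpi := Real.pi_pos
  have hT : 0 < 2 * Real.pi := by positivity
  obtain ⟨g, hgc, hgi, hg0, hg1, hgS⟩ : ∃ g : ℝ → Circle × ℝ, ContinuousOn g (Icc 0 (2 * Real.pi)) ∧
      InjOn g (Icc 0 (2 * Real.pi)) ∧ g 0 = p ∧ g (2 * Real.pi) = -p ∧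
      ∀ t ∈ Icc 0 (2 * Real.pi), g t ∈ S := by
    obtain ⟨f, l, r, hlr, hfc, hfi, hfl, hfr, hfS⟩ := hS
    have hd : 0 < (r - l) / (2 * Real.pi) := div_pos (by linarith) hT
    have hend : l + (r - l) / (2 * Real.pi) * (2 * Real.pi) = r := by field_simp; ring
    have hm : MapsTo (fun t => l + (r - l) / (2 * Real.pi) * t) (Icc 0 (2 * Real.pi)) (Icc l r) := by
      intro t ht
      refine ⟨?_, ?_⟩
      · have := mul_nonneg hd.le ht.1
        simp only; linarith
      · have := mul_le_mul_of_nonneg_left ht.2 hd.le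
        simp only; linarith
    refine ⟨fun t => f (l + (r - l) / (2 * Real.pi) * t), hfc.comp (by fun_prop) hm, ?_, ?_, ?_, ?_⟩
    · intro a ha b hb hab
      have := hfi (hm ha) (hm hb) hab
      simp only at this
      exact mul_left_cancel₀ hd.ne' (by linarith)
    · simp [hfl]
    · simp only [hend, hfr]
    · intro t ht
      rw [← hfS]
      exact ⟨_, hm ht, rfl⟩
  have hle : ∀ t ∈ Icc 0 (2 * Real.pi), |(g t).2| ≤ 1 := fun t ht => (hlt _ (hgS t ht)).le
  have hz : (0:ℝ) ∈ Icc 0 (2 * Real.pi) := ⟨le_rfl, hT.le⟩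
  have hTm : 2 * Real.pi ∈ Icc 0 (2 * Real.pi) := ⟨hT.le, le_rfl⟩
  have : Fact (0 < 2 * Real.pi) := ⟨hT⟩
  have hends : proj (g 0) = proj (g (2 * Real.pi)) := by rw [hg0, hg1, proj_neg]
  let γ : Circle → MobiusBand := fun z =>
    AddCircle.liftIco (2 * Real.pi) 0 (fun t => proj (g t)) (AddCircle.homeomorphCircle'.symm z)
  have hγc : Continuous γ := by
    have h1 : Continuous (AddCircle.liftIco (2 * Real.pi) 0 (fun t => proj (g t))) :=
      AddCircle.liftIco_zero_continuous hends (proj_cont.comp_continuousOn hgc)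
    exact h1.comp AddCircle.homeomorphCircle'.symm.continuous
  have hγ0 : ∀ t ∈ Ico 0 (2 * Real.pi), γ (Circle.exp t) = proj (g t) := by
    intro t ht
    have : AddCircle.homeomorphCircle'.symm (Circle.exp t) = (t : AddCircle (2 * Real.pi)) := by
      rw [Homeomorph.symm_apply_eq]; rfl
    simp only [γ, this]
    exact AddCircle.liftIco_zero_coe_apply (f := fun t => proj (g t)) ht
  have hγ : ∀ t ∈ Icc 0 (2 * Real.pi), γ (Circle.exp t) = proj (g t) := by
    intro t ht
    rcases eq_or_lt_of_le ht.2 with h | h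
    · rw [h, ← hends, ← hγ0 0 ⟨le_rfl, hT⟩, Circle.exp_two_pi, Circle.exp_zero]
    · exact hγ0 t ⟨ht.1, h⟩
  have hγi : Function.Injective γ := by
    intro z w hzw
    obtain ⟨s, hs, rfl⟩ := exists_circle_rep z
    obtain ⟨t, ht, rfl⟩ := exists_circle_rep w
    have hs' := Ico_subset_Icc_self hs
    have ht' := Ico_subset_Icc_self ht
    rw [hγ0 s hs, hγ0 t ht, proj_eq (hle _ hs') (hle _ ht')] at hzw
    rcases hzw with h | h
    · rw [hgi hs' ht' h]
    · have h1 : -g t ∈ S := h ▸ hgS s hs'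
      rcases hsimp _ (hgS t ht') h1 with h2 | h2
      · rw [h2, ← hg1] at h
        have := hgi hs' hTm h
        exact absurd this hs.2.ne
      · rw [← hg1] at h2
        exact absurd (hgi ht' hTm h2) ht.2.ne
  have hγe : Topology.IsEmbedding γ := (hγc.isClosedEmbedding hγi).isEmbedding
  have hrange : range γ ⊆ proj '' S := by
    rintro _ ⟨z, rfl⟩
    obtain ⟨s, hs, rfl⟩ := exists_circle_rep z
    rw [hγ0 s hs]
    exact ⟨_, hgS s (Ico_subset_Icc_self hs), rfl⟩
  have hbd : Disjoint (range γ) mobBdry := by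
    rw [disjoint_left]
    intro x hx hxb
    obtain ⟨q, hq, rfl⟩ := hrange hx
    exact (hlt q hq).ne ((proj_bdry (hlt q hq).le).1 hxb)
  obtain ⟨α, y, hα, hy, hy1, hl⟩ := mob_lift (fun s : ℝ => γ (Circle.exp s))
    (hγc.comp Circle.exp.continuous)
  have hst : ∀ s, ∃ n : ℤ, α (s + 2 * Real.pi) = α s + n * Real.pi ∧
      y (s + 2 * Real.pi) = (-1) ^ n * y s := by
    intro s
    rw [← strip_eq (hy1 _) (hy1 _), hl, hl, Circle.periodic_exp s]
  obtain ⟨k, hk⟩ := int_const (fun s => (α (s + 2 * Real.pi) - α s) / Real.pi) (by fun_prop) (by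
    intro s
    obtain ⟨n, hn, -⟩ := hst s
    exact ⟨n, by rw [hn]; field_simp; ring⟩)
  have hk' : ∀ s, α (s + 2 * Real.pi) = α s + k * Real.pi := by
    intro s
    have := hk s
    field_simp at this
    linarith
  have hyk : ∀ s, y (s + 2 * Real.pi) = (-1) ^ k * y s := by
    intro s
    obtain ⟨n, hn, h⟩ := hst s
    rw [hk', add_right_inj] at hn
    have : k = n := by exact_mod_cast mul_right_cancel₀ hpi.ne' hn
    rw [this, h]
  have hkodd : Odd k := by
    by_contra hke
    rw [Int.not_odd_iff_even] at hke
    have : PreconnectedSpace (Icc (0:ℝ) (2 * Real.pi)) :=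
      Subtype.preconnectedSpace isPreconnected_Icc
    have : Nonempty (Icc (0:ℝ) (2 * Real.pi)) := ⟨⟨0, hz⟩⟩
    have hcc : Continuous (fun w : Circle => (w : ℂ)) := continuous_subtype_val
    have hgr : Continuous (fun t : Icc (0:ℝ) (2 * Real.pi) => (g t).1) :=
      continuous_fst.comp (continuousOn_iff_continuous_domRestrict.1 hgc)
    have hpm : ∀ t ∈ Icc (0:ℝ) (2 * Real.pi), Circle.exp (α t) = (g t).1 ∨
        Circle.exp (α t) = -(g t).1 := by
      intro t ht
      have h1 := hl t
      rw [hγ t ht, proj_eq (hy1 _) (hle t ht)] at h1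
      rcases h1 with h | h
      · left; rw [← h]
      · right; exact congrArg Prod.fst h
    have hval : ∀ t : Icc (0:ℝ) (2 * Real.pi),
      ((Circle.exp (α t) : ℂ) * ((g t).1 : ℂ)⁻¹) = 1 ∨
      ((Circle.exp (α t) : ℂ) * ((g t).1 : ℂ)⁻¹) = -1 := by
      intro t
      rcases hpm t t.2 with h | h
      · left; rw [h, mul_inv_cancel₀ (Circle.coe_ne_zero _)]
      · right; rw [h, Circle.coe_neg, neg_mul, mul_inv_cancel₀ (Circle.coe_ne_zero _)]
    obtain ⟨c, hc⟩ := int_const (fun t : Icc (0:ℝ) (2 * Real.pi) =>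
      ((Circle.exp (α t) : ℂ) * ((g t).1 : ℂ)⁻¹).re) (by
        refine Complex.continuous_re.comp (Continuous.mul ?_ (Continuous.inv₀ ?_ ?_))
        · exact hcc.comp (Circle.exp.continuous.comp (hα.comp continuous_subtype_val))
        · exact hcc.comp hgr
        · intro t; exact Circle.coe_ne_zero _) (by
        intro t
        rcases hval t with h | h
        · exact ⟨1, by rw [h]; simp⟩
        · exact ⟨-1, by rw [h]; simp⟩)
    have h0 := hc ⟨0, hz⟩
    have h1 := hc ⟨2 * Real.pi, hTm⟩
    have e := hk' 0
    rw [zero_add] at e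
    have e2 : (Circle.exp (α (2 * Real.pi)) : ℂ) = Circle.exp (α 0) := by
      rw [e, exp_shift, hke.neg_one_zpow, one_mul]
    simp only [hg1, hg0, e2, Prod.fst_neg, Circle.coe_neg, inv_neg, mul_neg, Complex.neg_re] at h0 h1
    have hv := hval ⟨0, hz⟩
    simp only [hg0] at hv
    rcases hv with h | h <;> rw [h] at h0 h1 <;> simp at h0 h1 <;> linarith
  have hconn := odd_core γ hγe hbd α y hα hy hy1 hl k hkodd hk' (by
    intro s; rw [hyk, hkodd.neg_one_zpow]; ring)
  obtain ⟨γ', h1, h2⟩ := isCoreCurve_of γ hγe hbd hconn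
  exact ⟨γ', h1, h2 ▸ hrange⟩

end MobArc

namespace MobArc

theorem odd_fun (K : Set (Circle × ℝ)) (hK : IsClosed K)
    (hd : Disjoint K ((fun x => -x) ⁻¹' K)) :
    ∃ f : Circle × ℝ → ℝ, Continuous f ∧ (∀ p, f (-p) = - f p) ∧ ∀ p ∈ K, 0 < f p := by
  obtain ⟨h, h0, h1, -⟩ := exists_continuous_zero_one_of_isClosed hK
    (hK.preimage continuous_neg) hd
  have hn : Continuous (fun p : Circle × ℝ => h (-p)) := h.continuous.comp continuous_neg
  refine ⟨fun p => h (-p) - h p, hn.sub h.continuous, fun p => by simp, fun p hp => ?_⟩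
  have e1 : h p = 0 := h0 hp
  have e2 : h (-p) = 1 := h1 (show - -p ∈ K by simpa using hp)
  simp only [e1, e2]; norm_num

/-- The covering map from the strip. -/
noncomputable def cov (q : ℝ × ℝ) : Circle × ℝ := (Circle.exp q.1, q.2)

theorem cov_cont : Continuous cov :=
  (Circle.exp.continuous.comp continuous_fst).prodMk continuous_snd

theorem cov_open : IsOpenMap cov := by
  have h := Circle.isCoveringMap_exp.isLocalHomeomorph.isOpenMap.prodMap (IsOpenMap.id (X := ℝ))
  exact h

theorem cov_shift (q : ℝ × ℝ) : cov (q.1 + Real.pi, -q.2) = - cov q := by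
  refine Prod.ext (Circle.ext ?_) rfl
  simp [cov]

theorem box (p : Circle × ℝ) (W : Set (Circle × ℝ)) (hW : W ∈ nhds p) :
    ∃ D : Set (Circle × ℝ), IsClosed D ∧ ArcConn D ∧ Disjoint D ((fun x => -x) ⁻¹' D) ∧
      D ∈ nhds p ∧ D ⊆ W := by
  obtain ⟨w, b⟩ := p
  obtain ⟨a, rfl⟩ := Circle.exp_surjective w
  have hW' : cov ⁻¹' W ∈ nhds (a, b) := cov_cont.continuousAt.preimage_mem_nhds hW
  obtain ⟨ε, hε, hεW⟩ := Metric.nhds_basis_closedBall.mem_iff.1 hW'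
  let δ := min ε 1
  have hδ : 0 < δ := lt_min hε one_pos
  have hδ1 : δ ≤ 1 := min_le_right _ _
  have hpi := Real.pi_gt_three
  have hclose : ∀ q ∈ Metric.closedBall (a, b) δ, ∀ q' ∈ Metric.closedBall (a, b) δ,
      |q.1 - q'.1| ≤ 2 := by
    intro q hq q' hq'
    rw [Metric.mem_closedBall, Prod.dist_eq, max_le_iff, Real.dist_eq, Real.dist_eq, abs_le] at hq hq'
    rw [abs_le]
    constructor <;> linarith [hq.1.1, hq.1.2, hq'.1.1, hq'.1.2]
  have hinj : InjOn cov (Metric.closedBall (a, b) δ) := by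
    intro q hq q' hq' h
    rw [cov, cov, Prod.mk.injEq, Circle.exp_eq_exp] at h
    obtain ⟨⟨m, hm⟩, h2⟩ := h
    have h3 := hclose q hq q' hq'
    rw [hm, add_sub_cancel_left, abs_mul, abs_of_pos (by positivity : 0 < 2 * Real.pi)] at h3
    have h4 : |(m : ℝ)| < 1 := by nlinarith [abs_nonneg (m : ℝ)]
    have h5 : m = 0 := Int.abs_lt_one_iff.1 (by exact_mod_cast h4)
    rw [h5] at hm
    exact Prod.ext (by simpa using hm) h2
  refine ⟨cov '' Metric.closedBall (a, b) δ, ?_, ?_, ?_, ?_, ?_⟩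
  · exact ((isCompact_closedBall _ _).image cov_cont).isClosed
  · rintro _ ⟨q, hq, rfl⟩ _ ⟨q', hq', rfl⟩ hne
    have hqq : q ≠ q' := fun h => hne (by rw [h])
    have hseg : ∀ t ∈ Icc (0:ℝ) 1, AffineMap.lineMap q q' t ∈ Metric.closedBall (a, b) δ := by
      intro t ht
      exact (convex_closedBall (a, b) δ).segment_subset hq hq'
        (by rw [segment_eq_image_lineMap]; exact ⟨t, ht, rfl⟩)
    refine ⟨(fun t => cov (AffineMap.lineMap q q' t)) '' Icc (0:ℝ) 1, ?_,
      fun t => cov (AffineMap.lineMap q q' t), 0, 1, one_pos, ?_, ?_, by simp, by simp, rfl⟩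
    · rintro _ ⟨t, ht, rfl⟩
      exact ⟨_, hseg t ht, rfl⟩
    · exact (cov_cont.comp AffineMap.lineMap_continuous).continuousOn
    · intro s hs t ht hst
      exact AffineMap.lineMap_injective ℝ hqq (hinj (hseg s hs) (hseg t ht) hst)
  · rw [disjoint_left]
    rintro _ ⟨q, hq, rfl⟩ ⟨q', hq', h⟩
    simp only at h
    rw [← cov_shift, cov, cov, Prod.mk.injEq, Circle.exp_eq_exp] at h
    obtain ⟨⟨m, hm⟩, -⟩ := h
    have h3 := hclose q' hq' q hq
    have h4 : q'.1 - q.1 = (2 * m + 1 : ℤ) * Real.pi := by rw [hm]; push_cast; ring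
    rw [h4, abs_mul, abs_of_pos (by positivity : 0 < Real.pi)] at h3
    have h5 : |((2 * m + 1 : ℤ) : ℝ)| < 1 := by nlinarith [abs_nonneg ((2 * m + 1 : ℤ) : ℝ)]
    have h6 : 2 * m + 1 = 0 := Int.abs_lt_one_iff.1 (by exact_mod_cast h5)
    omega
  · exact cov_open.image_mem_nhds (x := (a, b)) (Metric.closedBall_mem_nhds _ hδ)
  · rintro _ ⟨q, hq, rfl⟩
    exact hεW (Metric.closedBall_subset_closedBall (min_le_left _ _) hq)

theorem exists_loop (G K : Set (Circle × ℝ)) (hG : IsClosed G) (hlt : ∀ x ∈ G, |x.2| < 1)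
    (hK : IsClosed K) (hd : Disjoint K ((fun x => -x) ⁻¹' K)) (hKG : K ∪ (fun x => -x) ⁻¹' K = G) :
    ∃ p S, IsArc S p (-p) ∧ (∀ x ∈ S, |x.2| < 1 ∧ x ∉ G) ∧
      ∀ x ∈ S, -x ∈ S → x = p ∨ x = -p := by
  have hKG1 : ∀ x ∈ K, x ∈ G := fun x hx => hKG ▸ Or.inl hx
  have hGneg : ∀ x, -x ∈ G → x ∈ G := by
    intro x hx
    rw [← hKG] at hx ⊢
    rcases hx with h | h
    · exact Or.inr h
    · exact Or.inl (by simpa using h)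
  let K' : Set (Circle × ℝ) := K ∪ {x | x.2 = 1}
  have hK' : IsClosed K' := hK.union (isClosed_eq continuous_snd continuous_const)
  have hd' : Disjoint K' ((fun x => -x) ⁻¹' K') := by
    rw [disjoint_left]
    rintro x (h | h) (h' | h')
    · exact disjoint_left.1 hd h h'
    · have := hlt x (hKG1 x h)
      have h2 : -x.2 = 1 := h'
      rw [← abs_neg, h2] at this; simp at this
    · have := hlt _ (hKG1 _ h')
      have h2 : x.2 = 1 := h
      simp [h2] at this
    · have h1 : x.2 = 1 := h
      have h2 : -x.2 = 1 := h'
      linarith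
  obtain ⟨f, hfc, hfo, hfp⟩ := odd_fun K' hK' hd'
  have hfG : ∀ x ∈ G, f x ≠ 0 := by
    intro x hx
    rw [← hKG] at hx
    rcases hx with h | h
    · exact (hfp x (Or.inl h)).ne'
    · have := hfp (-x) (Or.inl h)
      rw [hfo] at this; linarith
  have hf1 : ∀ x : Circle × ℝ, |x.2| = 1 → f x ≠ 0 := by
    intro x hx
    rcases (abs_eq (by norm_num)).1 hx with h | h
    · exact (hfp x (Or.inr h)).ne'
    · have := hfp (-x) (Or.inr (by simp [h]))
      rw [hfo] at this; linarith
  let Z : Set (Circle × ℝ) := {x | f x = 0} ∩ (univ ×ˢ Icc (-1) 1)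
  have hZc : IsCompact Z := (isCompact_univ.prod isCompact_Icc).inter_left
    (isClosed_eq hfc continuous_const)
  let W : Set (Circle × ℝ) := Gᶜ ∩ {x | |x.2| < 1}
  have hWo : IsOpen W := hG.isOpen_compl.inter
    (isOpen_lt (continuous_abs.comp continuous_snd) continuous_const)
  have hZW : Z ⊆ W := by
    rintro x ⟨h1, -, h2⟩
    exact ⟨fun h => hfG x h h1, lt_of_le_of_ne (abs_le.2 h2) fun h => hf1 x h h1⟩
  have hbox : ∀ p : Circle × ℝ, ∃ D : Set (Circle × ℝ), p ∈ Z → (IsClosed D ∧ ArcConn D ∧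
      Disjoint D ((fun x => -x) ⁻¹' D) ∧ D ∈ nhds p ∧ D ⊆ W) := by
    intro p
    by_cases hp : p ∈ Z
    · obtain ⟨D, hD⟩ := box p W (hWo.mem_nhds (hZW hp))
      exact ⟨D, fun _ => hD⟩
    · exact ⟨∅, fun h => absurd h hp⟩
  choose D hD using hbox
  obtain ⟨t, htZ, htc⟩ := hZc.elim_nhds_subcover D (fun x hx => (hD x hx).2.2.2.1)
  rcases dichotomy (fun x : Circle × ℝ => -x) continuous_neg (fun x => neg_neg x)
    (fun i : t => D i) (fun i => (hD i (htZ i i.2)).1) (fun i => (hD i (htZ i i.2)).2.1)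
    (fun i => (hD i (htZ i i.2)).2.2.1) with ⟨p, S, h1, h2, h3⟩ | ⟨K2, hK2, hd2, hc2⟩
  · refine ⟨p, S, h1, ?_, h3⟩
    intro x hx
    obtain ⟨i, h | h⟩ := h2 x hx
    · have := (hD i (htZ i i.2)).2.2.2.2 h
      exact ⟨this.2, this.1⟩
    · have := (hD i (htZ i i.2)).2.2.2.2 h
      refine ⟨by simpa using this.2, fun hxG => this.1 (hGneg _ (by simpa using hxG))⟩
  · exfalso
    obtain ⟨g, hgc, hgo, hgp⟩ := odd_fun K2 hK2 hd2
    have hgZ : ∀ x ∈ Z, g x ≠ 0 := by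
      intro x hx
      have h1 : x ∈ K2 ∪ (fun x => -x) ⁻¹' K2 := by
        rw [hc2]
        obtain ⟨i, hi, h⟩ := mem_iUnion₂.1 (htc hx)
        exact mem_iUnion.2 ⟨⟨i, hi⟩, Or.inl h⟩
      rcases h1 with h | h
      · exact (hgp x h).ne'
      · have := hgp (-x) h
        rw [hgo] at this; linarith
    let q : ℝ × ℝ → Circle × ℝ := fun p => cov (p.1, clamp p.2)
    have hq : Continuous q := cov_cont.comp (by have := clamp_cont; fun_prop)
    have hqo : ∀ a b, q (a + Real.pi, -b) = - q (a, b) := by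
      intro a b
      simp only [q, clamp_neg]
      exact cov_shift (a, clamp b)
    refine no_odd (fun p => Complex.equivRealProdCLM.symm (f (q p), g (q p))) ?_ ?_ ?_ ?_
    · exact Complex.equivRealProdCLM.symm.continuous.comp (by fun_prop)
    · intro p h0
      have h0' := (map_eq_zero_iff _ Complex.equivRealProdCLM.symm.injective).1 h0
      rw [Prod.mk_eq_zero] at h0'
      exact hgZ (q p) ⟨h0'.1, mem_univ _, abs_le.1 (clamp_abs _)⟩ h0'.2
    · intro a b
      rw [hqo, hfo, hgo, ← map_neg]; rfl
    · intro x
      show 0 < f (q (x, 1))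
      exact hfp _ (Or.inr (clamp_of (by simp)))

theorem main (n : ℕ) (e : Fin n → (↥(Set.Icc (0:ℝ) 1) → MobiusBand))
    (he : ∀ i, Topology.IsEmbedding (e i) ∧
      Disjoint (Set.range (e i)) mobBdry)
    (hno : ¬ ∃ γ, IsCoreCurve γ ∧ Set.range γ ⊆ ⋃ i, Set.range (e i)) :
    ∃ γ, IsCoreCurve γ ∧ Disjoint (Set.range γ) (⋃ i, Set.range (e i)) := by
  have hlift : ∀ i, ∃ P : Icc (0:ℝ) 1 → Circle × ℝ, Continuous P ∧ (∀ t, |(P t).2| ≤ 1) ∧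
      ∀ t, proj (P t) = e i t := by
    intro i
    obtain ⟨α, y, hα, hy, hy1, hl⟩ := mob_lift (fun s : ℝ => e i (projIcc 0 1 zero_le_one s))
      ((he i).1.continuous.comp continuous_projIcc)
    refine ⟨fun t => cov (α t, y t), cov_cont.comp (by fun_prop), fun t => hy1 t, fun t => ?_⟩
    have := hl t
    rw [projIcc_val] at this
    exact this
  choose P hPc hP1 hPl using hlift
  have hPlt : ∀ i t, |(P i t).2| < 1 := by
    intro i t
    refine lt_of_le_of_ne (hP1 i t) fun h => ?_
    have := (proj_bdry (hP1 i t)).2 h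
    rw [hPl] at this
    exact disjoint_left.1 (he i).2 ⟨t, rfl⟩ this
  have hPi : ∀ i, Function.Injective (P i) := by
    intro i s t h
    apply (he i).1.injective
    rw [← hPl, ← hPl, h]
  have hproj : ∀ x : Circle × ℝ, (∃ i, x ∈ range (P i) ∨ -x ∈ range (P i)) →
      proj x ∈ ⋃ i, range (e i) := by
    rintro x ⟨i, ⟨t, ht⟩ | ⟨t, ht⟩⟩
    · exact mem_iUnion.2 ⟨i, t, by rw [← hPl, ht]⟩
    · exact mem_iUnion.2 ⟨i, t, by rw [← hPl, ht, proj_neg]⟩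
  have hxlt : ∀ x : Circle × ℝ, (∃ i, x ∈ range (P i) ∨ -x ∈ range (P i)) → |x.2| < 1 := by
    rintro x ⟨i, ⟨t, ht⟩ | ⟨t, ht⟩⟩
    · rw [← ht]; exact hPlt i t
    · have := hPlt i t
      rw [ht] at this; simpa using this
  have hcl : ∀ i, IsClosed (range (P i)) := fun i => (isCompact_range (hPc i)).isClosed
  have hac : ∀ i, ArcConn (range (P i)) := by
    rintro i _ ⟨s, rfl⟩ _ ⟨t, rfl⟩ hne
    have hst : (s : ℝ) ≠ t := fun h => hne (by rw [Subtype.ext h])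
    have hseg : ∀ u ∈ Icc (0:ℝ) 1, AffineMap.lineMap (k := ℝ) (s : ℝ) (t : ℝ) u ∈ Icc (0:ℝ) 1 := by
      intro u hu
      exact (convex_Icc (𝕜 := ℝ) (0:ℝ) 1).segment_subset s.2 t.2
        (by rw [segment_eq_image_lineMap]; exact ⟨u, hu, rfl⟩)
    let Q : ℝ → Circle × ℝ := fun u => P i (projIcc 0 1 zero_le_one (AffineMap.lineMap (k := ℝ) (s : ℝ) (t : ℝ) u))
    refine ⟨Q '' Icc (0:ℝ) 1, ?_, Q, 0, 1, one_pos, ?_, ?_, ?_, ?_, rfl⟩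
    · rintro _ ⟨u, hu, rfl⟩
      exact ⟨_, rfl⟩
    · exact ((hPc i).comp (continuous_projIcc.comp AffineMap.lineMap_continuous)).continuousOn
    · intro u hu v hv huv
      have h1 := hPi i huv
      rw [projIcc_of_mem _ (hseg u hu), projIcc_of_mem _ (hseg v hv)] at h1
      exact AffineMap.lineMap_injective ℝ hst (congrArg Subtype.val h1)
    · simp [Q]
    · simp [Q]
  have hdj : ∀ i, Disjoint (range (P i)) ((fun x => -x) ⁻¹' range (P i)) := by
    intro i
    rw [disjoint_left]
    rintro _ ⟨s, rfl⟩ ⟨t, ht⟩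
    simp only at ht
    have h1 : s = t := by
      apply (he i).1.injective
      rw [← hPl, ← hPl, ht, proj_neg]
    subst h1
    have h2 : ((P i s).1 : ℂ) = -((P i s).1 : ℂ) := by
      have := congrArg (fun z : Circle × ℝ => (z.1 : ℂ)) ht
      simpa using this
    have h3 := (P i s).1.coe_ne_zero
    apply h3
    have : (2 : ℂ) * (P i s).1 = 0 := by linear_combination h2
    simpa using this
  rcases dichotomy (fun x : Circle × ℝ => -x) continuous_neg (fun x => neg_neg x)
    (fun i => range (P i)) hcl hac hdj with ⟨p, S, h1, h2, h3⟩ | ⟨K, hK, hd, hc⟩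
  · exfalso
    obtain ⟨γ, hγ, hr⟩ := loop_core p S h1 (fun x hx => hxlt x (h2 x hx)) h3
    refine hno ⟨γ, hγ, hr.trans ?_⟩
    rintro _ ⟨x, hx, rfl⟩
    exact hproj x (h2 x hx)
  · have hGm : ∀ x : Circle × ℝ, x ∈ K ∪ (fun x => -x) ⁻¹' K ↔
        ∃ i, x ∈ range (P i) ∨ -x ∈ range (P i) := by
      intro x
      rw [hc, mem_iUnion]; rfl
    obtain ⟨p, S, h1, h2, h3⟩ := exists_loop _ K (hK.union (hK.preimage continuous_neg))
      (fun x hx => hxlt x ((hGm x).1 hx)) hK hd rfl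
    obtain ⟨γ, hγ, hr⟩ := loop_core p S h1 (fun x hx => (h2 x hx).1) h3
    refine ⟨γ, hγ, ?_⟩
    rw [disjoint_left]
    intro m hm hm'
    obtain ⟨x, hx, rfl⟩ := hr hm
    obtain ⟨i, t, ht⟩ := mem_iUnion.1 hm'
    apply (h2 x hx).2
    rw [hGm]
    rw [← hPl, proj_eq (hP1 i t) (h2 x hx).1.le] at ht
    exact ⟨i, ht.imp (fun h => ⟨t, h⟩) (fun h => ⟨t, h⟩)⟩

end MobArc

end

/-- The Claim in Case 2 of Section 5: if `Γ` is a finite 1-complex in the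
interior of the Möbius band `F` (given by finitely many embedded 1-cells)
that does not contain a core curve of `F` as a subcomplex, then `F` has a
core curve disjoint from `Γ`. -/
theorem stmt13 (n : ℕ) (e : Fin n → (↥(Set.Icc (0:ℝ) 1) → MobiusBand))
    (he : ∀ i, Topology.IsEmbedding (e i) ∧
      Disjoint (Set.range (e i)) mobBdry)
    (hno : ¬ ∃ γ, IsCoreCurve γ ∧ Set.range γ ⊆ ⋃ i, Set.range (e i)) :
    ∃ γ, IsCoreCurve γ ∧ Disjoint (Set.range γ) (⋃ i, Set.range (e i)) := by
  exact MobArc.main n e he hno
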